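/- Every ergodic system (X, μ, T₁, T₂) on a standard Borel probability space admits an ergodic magic extension: there exist an ergodic system (Y, ν, S₁, S₂) which is magic and a factor map π : (Y, ν, S₁, S₂) → (X, μ, T₁, T₂). -/

import Mathlib

open MeasureTheory Filter

universe u

/-- The σ-algebra `ℐ(T)` of `T`-invariant measurable sets. -/
def invSigma {X : Type*} [m : MeasurableSpace X] (T : X → X) : MeasurableSpace X where
  MeasurableSet' s := MeasurableSet s ∧ T ⁻¹' s = s
  measurableSet_empty := ⟨MeasurableSet.empty, rfl⟩
  measurableSet_compl s hs := ⟨hs.1.compl, by rw [Set.preimage_compl, hs.2]⟩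
  measurableSet_iUnion f hf :=
    ⟨MeasurableSet.iUnion fun i => (hf i).1, by
      rw [Set.preimage_iUnion]
      exact Set.iUnion_congr fun i => (hf i).2⟩

/-- The box average of `f` with respect to `(T₁, T₂)` equals `L`: for every
`n₂` the inner Cesàro limit `c n₂` exists, and the Cesàro averages of `c`
converge to `L`. -/
def HasBoxAvg {X : Type*} [MeasurableSpace X] (μ : Measure X)
    (T₁ T₂ : X → X) (f : X → ℝ) (L : ℝ) : Prop :=
  ∃ c : ℕ → ℝ,
    (∀ n₂ : ℕ, Tendsto (fun N₁ : ℕ =>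
        (∑ n₁ ∈ Finset.range N₁,
          ∫ x, f x * f (T₁^[n₁] x) * f (T₂^[n₂] x) * f (T₁^[n₁] (T₂^[n₂] x)) ∂μ)
          / (N₁ : ℝ))
      atTop (nhds (c n₂))) ∧
    Tendsto (fun N₂ : ℕ => (∑ n₂ ∈ Finset.range N₂, c n₂) / (N₂ : ℝ))
      atTop (nhds L)

/-- A system is magic if every bounded measurable function whose conditional
expectation on `ℐ(T₁) ∨ ℐ(T₂)` vanishes has box average `0`. -/
def IsMagic {X : Type*} [MeasurableSpace X] (μ : Measure X) (T₁ T₂ : X ≃ᵐ X) : Prop :=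
  ∀ f : X → ℝ, Measurable f → (∃ C : ℝ, ∀ x, |f x| ≤ C) →
    (μ[f | invSigma ⇑T₁ ⊔ invSigma ⇑T₂] =ᵐ[μ] 0) →
    HasBoxAvg μ ⇑T₁ ⇑T₂ f 0

open scoped Topology ENNReal

/-- A real function is bounded measurable if it is measurable and uniformly bounded. -/
def BddMeas {X : Type*} [MeasurableSpace X] (f : X → ℝ) : Prop :=
  Measurable f ∧ ∃ C : ℝ, ∀ x, |f x| ≤ C

namespace BddMeas

variable {X Y : Type*} [MeasurableSpace X] [MeasurableSpace Y] {f g : X → ℝ}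

theorem const (c : ℝ) : BddMeas fun _ : X => c := ⟨measurable_const, |c|, fun _ => le_rfl⟩

theorem add (hf : BddMeas f) (hg : BddMeas g) : BddMeas fun x => f x + g x := by
  obtain ⟨hf, C, hC⟩ := hf
  obtain ⟨hg, D, hD⟩ := hg
  exact ⟨hf.add hg, C + D, fun x => (abs_add_le _ _).trans (add_le_add (hC x) (hD x))⟩

theorem mul (hf : BddMeas f) (hg : BddMeas g) : BddMeas fun x => f x * g x := by
  obtain ⟨hf, C, hC⟩ := hf
  obtain ⟨hg, D, hD⟩ := hg
  refine ⟨hf.mul hg, C * D, fun x => ?_⟩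
  rw [abs_mul]
  exact mul_le_mul (hC x) (hD x) (abs_nonneg _) ((abs_nonneg _).trans (hC x))

theorem sub (hf : BddMeas f) (hg : BddMeas g) : BddMeas fun x => f x - g x := by
  simpa [sub_eq_add_neg] using hf.add ((const (-1)).mul hg)

theorem comp (hf : BddMeas f) {φ : Y → X} (hφ : Measurable φ) : BddMeas fun y => f (φ y) :=
  ⟨hf.1.comp hφ, hf.2.imp fun _ h _ => h _⟩

theorem indicator_one {s : Set X} (hs : MeasurableSet s) :
    BddMeas (s.indicator fun _ => (1 : ℝ)) := by
  refine ⟨measurable_const.indicator hs, 1, fun x => ?_⟩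
  by_cases h : x ∈ s <;> simp [h]

theorem sum {ι : Type*} (s : Finset ι) {F : ι → X → ℝ} (hF : ∀ i, BddMeas (F i)) :
    BddMeas fun x => ∑ i ∈ s, F i x := by
  classical
  induction s using Finset.induction_on with
  | empty => simpa using const (X := X) 0
  | insert a s ha ih => simpa [Finset.sum_insert ha] using (hF a).add ih

theorem div_const (hf : BddMeas f) (c : ℝ) : BddMeas fun x => f x / c := by
  simpa [div_eq_mul_inv] using hf.mul (const c⁻¹)

theorem memLp (hf : BddMeas f) {μ : Measure X} [IsFiniteMeasure μ] (p : ℝ≥0∞) : MemLp f p μ := by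
  obtain ⟨hf, C, hC⟩ := hf
  exact MemLp.of_bound hf.aestronglyMeasurable C (ae_of_all _ hC)

theorem integrable (hf : BddMeas f) {μ : Measure X} [IsFiniteMeasure μ] : Integrable f μ :=
  memLp_one_iff_integrable.1 (hf.memLp 1)

theorem integral_comp (hf : BddMeas f) {μ : Measure Y} {ν : Measure X} {T : Y → X}
    (hT : MeasurePreserving T μ ν) : ∫ y, f (T y) ∂μ = ∫ x, f x ∂ν := by
  rw [← hT.map_eq, integral_map hT.aemeasurable hf.1.aestronglyMeasurable]

theorem integral_comp_mul (hf : BddMeas f) {w : X → ℝ} {μ : Measure X} {T : X → X}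
    (hT : MeasurePreserving T μ μ) (hw : BddMeas w) (hwT : w ∘ T =ᵐ[μ] w) :
    ∫ x, f (T x) * w x ∂μ = ∫ x, f x * w x ∂μ := by
  have : ∫ x, f (T x) * w x ∂μ = ∫ x, (fun y => f y * w y) (T x) ∂μ := by
    refine integral_congr_ae ?_
    filter_upwards [hwT] with x hx
    simp only [Function.comp] at hx
    simp [hx]
  rw [this, (hf.mul hw).integral_comp hT]

theorem integral_add (hf : BddMeas f) (hg : BddMeas g) (μ : Measure X) [IsFiniteMeasure μ] :
    ∫ x, (f x + g x) ∂μ = ∫ x, f x ∂μ + ∫ x, g x ∂μ :=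
  MeasureTheory.integral_add hf.integrable hg.integrable

theorem integral_sub (hf : BddMeas f) (hg : BddMeas g) (μ : Measure X) [IsFiniteMeasure μ] :
    ∫ x, (f x - g x) ∂μ = ∫ x, f x ∂μ - ∫ x, g x ∂μ :=
  MeasureTheory.integral_sub hf.integrable hg.integrable

/-- The Cauchy-Schwarz inequality for bounded measurable functions. -/
theorem sq_integral_mul_le (hf : BddMeas f) (hg : BddMeas g) (μ : Measure X) [IsFiniteMeasure μ] :
    (∫ x, f x * g x ∂μ) ^ 2 ≤ (∫ x, f x * f x ∂μ) * ∫ x, g x * g x ∂μ := by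
  have key : ∀ t : ℝ, 0 ≤ (∫ x, f x * f x ∂μ) * (t * t) + (2 * ∫ x, f x * g x ∂μ) * t +
      ∫ x, g x * g x ∂μ := by
    intro t
    have h0 : 0 ≤ ∫ x, (t * f x + g x) * (t * f x + g x) ∂μ :=
      integral_nonneg fun y => mul_self_nonneg _
    have : ∀ x, (t * f x + g x) * (t * f x + g x) =
        (t * t) * (f x * f x) + (2 * t) * (f x * g x) + g x * g x := fun x => by ring
    simp_rw [this] at h0
    rw [(((const _).mul (hf.mul hf)).add ((const _).mul (hf.mul hg))).integral_add (hg.mul hg),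
      ((const _).mul (hf.mul hf)).integral_add ((const _).mul (hf.mul hg)),
      integral_const_mul, integral_const_mul] at h0
    linarith
  have := discrim_le_zero key
  rw [discrim] at this
  linarith

end BddMeas

section MeanErgodic

variable {X : Type*} [mX : MeasurableSpace X]

/-- The σ-algebra of measurable sets which are almost everywhere invariant under both
transformations. -/
def aeInv (μ : Measure X) (T₁ T₂ : X → X) : MeasurableSpace X where
  MeasurableSet' s := MeasurableSet s ∧ T₁ ⁻¹' s =ᵐ[μ] s ∧ T₂ ⁻¹' s =ᵐ[μ] s
  measurableSet_empty := ⟨MeasurableSet.empty, ae_eq_refl _, ae_eq_refl _⟩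
  measurableSet_compl s hs := ⟨hs.1.compl, hs.2.1.compl, hs.2.2.compl⟩
  measurableSet_iUnion f hf := by
    refine ⟨MeasurableSet.iUnion fun i => (hf i).1, ?_, ?_⟩
    · rw [Set.preimage_iUnion]
      exact Filter.EventuallyEq.countable_iUnion fun i => (hf i).2.1
    · rw [Set.preimage_iUnion]
      exact Filter.EventuallyEq.countable_iUnion fun i => (hf i).2.2

theorem aeInv_le (μ : Measure X) (T₁ T₂ : X → X) : aeInv μ T₁ T₂ ≤ mX := fun _ h => h.1

theorem measurable_aeInv {μ : Measure X} {T₁ T₂ : X → X} {f : X → ℝ} (hf : Measurable f)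
    (h₁ : f ∘ T₁ =ᵐ[μ] f) (h₂ : f ∘ T₂ =ᵐ[μ] f) : Measurable[aeInv μ T₁ T₂] f := by
  intro s hs
  refine ⟨hf hs, ?_, ?_⟩
  · filter_upwards [h₁] with x hx
    exact propext (by
      change f (T₁ x) ∈ s ↔ f x ∈ s
      rw [← hx]; rfl)
  · filter_upwards [h₂] with x hx
    exact propext (by
      change f (T₂ x) ∈ s ↔ f x ∈ s
      rw [← hx]; rfl)

/-- The average of the two Koopman operators. -/
noncomputable def avgOp (T₁ T₂ : X → X) (f : X → ℝ) : X → ℝ :=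
  fun x => (f (T₁ x) + f (T₂ x)) / 2

/-- The ergodic averages of the averaging operator `avgOp`. -/
noncomputable def ergAvg (T₁ T₂ : X → X) (N : ℕ) (f : X → ℝ) : X → ℝ :=
  fun x => (∑ n ∈ Finset.range N, (avgOp T₁ T₂)^[n] f x) / N

theorem BddMeas.avgOp {T₁ T₂ : X → X} (h₁ : Measurable T₁) (h₂ : Measurable T₂) {f : X → ℝ}
    (hf : BddMeas f) : BddMeas (avgOp T₁ T₂ f) :=
  ((hf.comp h₁).add (hf.comp h₂)).div_const 2

theorem BddMeas.avgOp_iterate {T₁ T₂ : X → X} (h₁ : Measurable T₁) (h₂ : Measurable T₂)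
    {f : X → ℝ} (hf : BddMeas f) (n : ℕ) : BddMeas ((_root_.avgOp T₁ T₂)^[n] f) := by
  induction n with
  | zero => exact hf
  | succ n ih =>
    rw [Function.iterate_succ_apply']
    exact ih.avgOp h₁ h₂

theorem BddMeas.ergAvg {T₁ T₂ : X → X} (h₁ : Measurable T₁) (h₂ : Measurable T₂) {f : X → ℝ}
    (hf : BddMeas f) (N : ℕ) : BddMeas (ergAvg T₁ T₂ N f) :=
  (BddMeas.sum _ fun n => hf.avgOp_iterate h₁ h₂ n).div_const _

omit mX in
theorem avgOp_self_iterate (T : X → X) (f : X → ℝ) (n : ℕ) :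
    (avgOp T T)^[n] f = fun x => f (T^[n] x) := by
  induction n with
  | zero => rfl
  | succ n ih =>
    rw [Function.iterate_succ_apply', ih]
    funext x
    simp [avgOp]

theorem integral_avgOp_mul {μ : Measure X} [IsFiniteMeasure μ] {T₁ T₂ : X → X}
    (h₁ : MeasurePreserving T₁ μ μ) (h₂ : MeasurePreserving T₂ μ μ) {f w : X → ℝ}
    (hf : BddMeas f) (hw : BddMeas w) (hw₁ : w ∘ T₁ =ᵐ[μ] w) (hw₂ : w ∘ T₂ =ᵐ[μ] w) :
    ∫ x, avgOp T₁ T₂ f x * w x ∂μ = ∫ x, f x * w x ∂μ := by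
  have : ∀ x, avgOp T₁ T₂ f x * w x = (f (T₁ x) * w x + f (T₂ x) * w x) / 2 := fun x => by
    simp only [avgOp]; ring
  simp_rw [this]
  rw [integral_div, integral_add ((hf.comp h₁.measurable).mul hw).integrable
    ((hf.comp h₂.measurable).mul hw).integrable, hf.integral_comp_mul h₁ hw hw₁,
    hf.integral_comp_mul h₂ hw hw₂]
  ring

theorem integral_ergAvg_mul {μ : Measure X} [IsFiniteMeasure μ] {T₁ T₂ : X → X}
    (h₁ : MeasurePreserving T₁ μ μ) (h₂ : MeasurePreserving T₂ μ μ) {f w : X → ℝ}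
    (hf : BddMeas f) (hw : BddMeas w) (hw₁ : w ∘ T₁ =ᵐ[μ] w) (hw₂ : w ∘ T₂ =ᵐ[μ] w)
    {N : ℕ} (hN : N ≠ 0) :
    ∫ x, ergAvg T₁ T₂ N f x * w x ∂μ = ∫ x, f x * w x ∂μ := by
  have hit : ∀ n, ∫ x, (avgOp T₁ T₂)^[n] f x * w x ∂μ = ∫ x, f x * w x ∂μ := by
    intro n
    induction n with
    | zero => rfl
    | succ n ih =>
      rw [Function.iterate_succ_apply', integral_avgOp_mul h₁ h₂
        (hf.avgOp_iterate h₁.measurable h₂.measurable n) hw hw₁ hw₂, ih]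
  simp only [ergAvg, div_mul_eq_mul_div, Finset.sum_mul]
  rw [integral_div, integral_finsetSum _ fun n _ =>
    ((hf.avgOp_iterate h₁.measurable h₂.measurable n).mul hw).integrable]
  simp only [hit, Finset.sum_const, Finset.card_range, nsmul_eq_mul]
  field_simp

/-- The average of the two Koopman operators, on `L²`. -/
noncomputable def koopmanAvg (μ : Measure X) {T₁ T₂ : X → X}
    (h₁ : MeasurePreserving T₁ μ μ) (h₂ : MeasurePreserving T₂ μ μ) :
    Lp ℝ 2 μ →L[ℝ] Lp ℝ 2 μ :=
  (1 / 2 : ℝ) • ((Lp.compMeasurePreservingₗᵢ ℝ T₁ h₁).toContinuousLinearMap +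
    (Lp.compMeasurePreservingₗᵢ ℝ T₂ h₂).toContinuousLinearMap)

theorem koopmanAvg_apply {μ : Measure X} {T₁ T₂ : X → X}
    (h₁ : MeasurePreserving T₁ μ μ) (h₂ : MeasurePreserving T₂ μ μ) (g : Lp ℝ 2 μ) :
    koopmanAvg μ h₁ h₂ g = (1 / 2 : ℝ) • (Lp.compMeasurePreserving T₁ h₁ g +
      Lp.compMeasurePreserving T₂ h₂ g) := rfl

theorem norm_koopmanAvg_le {μ : Measure X} {T₁ T₂ : X → X}
    (h₁ : MeasurePreserving T₁ μ μ) (h₂ : MeasurePreserving T₂ μ μ) :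
    ‖koopmanAvg μ h₁ h₂‖ ≤ 1 := by
  refine ContinuousLinearMap.opNorm_le_bound _ zero_le_one fun g => ?_
  rw [koopmanAvg_apply, norm_smul]
  have := norm_add_le (Lp.compMeasurePreserving T₁ h₁ g) (Lp.compMeasurePreserving T₂ h₂ g)
  rw [Lp.norm_compMeasurePreserving, Lp.norm_compMeasurePreserving] at this
  norm_num
  linarith

theorem fixed_of_koopmanAvg_fixed {μ : Measure X} {T₁ T₂ : X → X}
    (h₁ : MeasurePreserving T₁ μ μ) (h₂ : MeasurePreserving T₂ μ μ) {g : Lp ℝ 2 μ}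
    (hg : koopmanAvg μ h₁ h₂ g = g) :
    Lp.compMeasurePreserving T₁ h₁ g = g ∧ Lp.compMeasurePreserving T₂ h₂ g = g := by
  rw [koopmanAvg_apply] at hg
  set u := Lp.compMeasurePreserving T₁ h₁ g with hu
  set v := Lp.compMeasurePreserving T₂ h₂ g with hv
  have hnu : ‖u‖ = ‖g‖ := Lp.norm_compMeasurePreserving _ _
  have hnv : ‖v‖ = ‖g‖ := Lp.norm_compMeasurePreserving _ _
  have hsum : u + v = (2 : ℝ) • g := by
    rw [← hg, smul_smul]; norm_num
  have hpar := parallelogram_law_with_norm ℝ u v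
  rw [hsum, norm_smul, hnu, hnv] at hpar
  have : ‖u - v‖ = 0 := by
    norm_num at hpar
    nlinarith
  have huv : u = v := sub_eq_zero.1 (norm_eq_zero.1 this)
  have hug : u = g := by
    rw [← huv, ← two_smul ℝ u] at hsum
    exact smul_right_injective _ (two_ne_zero (α := ℝ)) hsum
  exact ⟨hug, huv ▸ hug⟩

theorem koopmanAvg_ae_eq {μ : Measure X} {T₁ T₂ : X → X}
    (h₁ : MeasurePreserving T₁ μ μ) (h₂ : MeasurePreserving T₂ μ μ) {g : Lp ℝ 2 μ} {f : X → ℝ}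
    (hg : g =ᵐ[μ] f) : koopmanAvg μ h₁ h₂ g =ᵐ[μ] avgOp T₁ T₂ f := by
  rw [koopmanAvg_apply]
  filter_upwards [Lp.coeFn_smul (1 / 2 : ℝ) (Lp.compMeasurePreserving T₁ h₁ g +
      Lp.compMeasurePreserving T₂ h₂ g), Lp.coeFn_add (Lp.compMeasurePreserving T₁ h₁ g)
      (Lp.compMeasurePreserving T₂ h₂ g), Lp.coeFn_compMeasurePreserving g h₁,
      Lp.coeFn_compMeasurePreserving g h₂, h₁.quasiMeasurePreserving.ae_eq_comp hg,
      h₂.quasiMeasurePreserving.ae_eq_comp hg] with x e1 e2 e3 e4 e5 e6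
  rw [e1, Pi.smul_apply, e2, Pi.add_apply, e3, e4, e5, e6]
  simp only [avgOp, Function.comp, smul_eq_mul]
  ring

/-- The mean ergodic theorem for a pair of measure-preserving maps: the averages converge in `L²`
to the conditional expectation on the invariant σ-algebra. -/
theorem tendsto_ergAvg {μ : Measure X} [IsFiniteMeasure μ] {T₁ T₂ : X → X}
    (h₁ : MeasurePreserving T₁ μ μ) (h₂ : MeasurePreserving T₂ μ μ) {f : X → ℝ}
    (hf : BddMeas f) :
    Tendsto (fun N => ∫ x, (ergAvg T₁ T₂ N f x - (μ[f|aeInv μ T₁ T₂]) x) ^ 2 ∂μ)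
      atTop (𝓝 0) := by
  set A := koopmanAvg μ h₁ h₂ with hA
  set F : Lp ℝ 2 μ := (hf.memLp 2).toLp f with hF
  have hFf : F =ᵐ[μ] f := (hf.memLp 2).coeFn_toLp
  have hlim := A.tendsto_birkhoffAverage_orthogonalProjection (norm_koopmanAvg_le h₁ h₂) F
  set p : Lp ℝ 2 μ := ((A.eqLocus (1 : Lp ℝ 2 μ →L[ℝ] Lp ℝ 2 μ)).orthogonalProjectionOnto F :
    Lp ℝ 2 μ) with hp
  have hpfix : A p = p :=
    ((A.eqLocus (1 : Lp ℝ 2 μ →L[ℝ] Lp ℝ 2 μ)).orthogonalProjectionOnto F).2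
  obtain ⟨hp₁, hp₂⟩ := fixed_of_koopmanAvg_fixed h₁ h₂ hpfix
  have hpm : AEStronglyMeasurable[aeInv μ T₁ T₂] p μ := by
    obtain ⟨q, hq, hpq⟩ := (Lp.aestronglyMeasurable p).aemeasurable
    have hinv : ∀ T : X → X, ∀ hT : MeasurePreserving T μ μ,
        Lp.compMeasurePreserving T hT p = p → q ∘ T =ᵐ[μ] q := by
      intro T hT hTp
      have e1 := Lp.coeFn_compMeasurePreserving p hT
      rw [hTp] at e1
      exact ((hT.quasiMeasurePreserving.ae_eq_comp hpq).symm.trans e1.symm).trans hpq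
    exact ⟨q, (measurable_aeInv hq (hinv _ h₁ hp₁) (hinv _ h₂ hp₂)).stronglyMeasurable, hpq⟩
  have hpE : p =ᵐ[μ] μ[f|aeInv μ T₁ T₂] := by
    refine ae_eq_condExp_of_forall_setIntegral_eq (aeInv_le μ T₁ T₂) hf.integrable
      (fun s _ _ => ((Lp.memLp p).integrable one_le_two).integrableOn) ?_ hpm
    intro s hs _
    have hμs : μ s ≠ ∞ := measure_ne_top μ s
    have hfix : A (indicatorConstLp 2 hs.1 hμs (1 : ℝ)) = indicatorConstLp 2 hs.1 hμs (1 : ℝ) := by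
      apply Lp.ext
      refine (koopmanAvg_ae_eq h₁ h₂ indicatorConstLp_coeFn).trans
        (EventuallyEq.trans ?_ indicatorConstLp_coeFn.symm)
      filter_upwards [hs.2.1.mem_iff, hs.2.2.mem_iff] with x hx1 hx2
      simp only [Set.mem_preimage] at hx1 hx2
      by_cases hx : x ∈ s <;> simp [avgOp, hx1, hx2, hx]
    have horth := (A.eqLocus (1 : Lp ℝ 2 μ →L[ℝ] Lp ℝ 2 μ)).starProjection_inner_eq_zero F
      (indicatorConstLp 2 hs.1 hμs (1 : ℝ)) hfix
    rw [real_inner_comm, L2.inner_indicatorConstLp_one hs.1 hμs] at horth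
    have e : ∀ᵐ x ∂μ, (F - (A.eqLocus (1 : Lp ℝ 2 μ →L[ℝ] Lp ℝ 2 μ)).starProjection F : Lp ℝ 2 μ) x
        = f x - p x := by
      filter_upwards [Lp.coeFn_sub F p, hFf] with x hx hx2
      have : (F - (A.eqLocus (1 : Lp ℝ 2 μ →L[ℝ] Lp ℝ 2 μ)).starProjection F : Lp ℝ 2 μ) = F - p :=
        rfl
      rw [this, hx, Pi.sub_apply, hx2]
    rw [setIntegral_congr_ae (g := fun x => f x - p x) hs.1 (e.mono fun x hx _ => hx),
      integral_sub hf.integrable.integrableOn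
        ((Lp.memLp p).integrable one_le_two).integrableOn] at horth
    linarith
  have hav : ∀ N, (birkhoffAverage ℝ A _root_.id N F : Lp ℝ 2 μ) =ᵐ[μ] ergAvg T₁ T₂ N f := by
    intro N
    have hit : ∀ n, (A^[n] F : Lp ℝ 2 μ) =ᵐ[μ] (avgOp T₁ T₂)^[n] f := by
      intro n
      induction n with
      | zero => exact hFf
      | succ n ih =>
        rw [Function.iterate_succ_apply', Function.iterate_succ_apply']
        exact koopmanAvg_ae_eq h₁ h₂ ih
    have hsum : ∀ s : Finset ℕ, ((∑ n ∈ s, A^[n] F : Lp ℝ 2 μ)) =ᵐ[μ]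
        fun x => ∑ n ∈ s, (avgOp T₁ T₂)^[n] f x := by
      intro s
      induction s using Finset.induction_on with
      | empty =>
        simp only [Finset.sum_empty]
        exact Lp.coeFn_zero ℝ 2 μ
      | insert a s ha ih =>
        rw [Finset.sum_insert ha]
        filter_upwards [Lp.coeFn_add (A^[a] F) (∑ n ∈ s, A^[n] F), hit a, ih] with x e1 e2 e3
        rw [e1, Pi.add_apply, e2, e3, Finset.sum_insert ha]
    simp only [birkhoffAverage, birkhoffSum, _root_.id]
    filter_upwards [Lp.coeFn_smul (N : ℝ)⁻¹ (∑ n ∈ Finset.range N, A^[n] F),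
      hsum (Finset.range N)] with x e1 e2
    rw [e1, Pi.smul_apply, e2]
    simp [ergAvg, div_eq_inv_mul]
  have hn : Tendsto (fun N => ‖birkhoffAverage ℝ A _root_.id N F - p‖ ^ 2) atTop (𝓝 0) := by
    have := (hlim.sub_const p).norm.pow 2
    simpa [hp] using this
  refine hn.congr fun N => ?_
  rw [← real_inner_self_eq_norm_sq, L2.inner_def]
  refine integral_congr_ae ?_
  filter_upwards [Lp.coeFn_sub (birkhoffAverage ℝ A _root_.id N F) p, hav N, hpE] with x e1 e2 e3
  rw [e1, Pi.sub_apply, e2, e3]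
  simp [pow_two]

end MeanErgodic

section ErgodicDecomposition

open ProbabilityTheory

theorem ae_indicator_comp {X : Type*} [MeasurableSpace X] {μ : Measure X} {T : X → X} {s : Set X}
    (h : T ⁻¹' s =ᵐ[μ] s) :
    (s.indicator fun _ => (1 : ℝ)) ∘ T =ᵐ[μ] s.indicator fun _ => (1 : ℝ) := by
  filter_upwards [h.mem_iff] with x hx
  simp only [Set.mem_preimage] at hx
  by_cases hxs : x ∈ s <;> simp [hx, hxs]

theorem integral_mul_indicator_one {X : Type*} [MeasurableSpace X] {μ : Measure X} {s : Set X}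
    (hs : MeasurableSet s) (f : X → ℝ) :
    ∫ x, f x * s.indicator (fun _ => (1 : ℝ)) x ∂μ = ∫ x in s, f x ∂μ := by
  rw [← integral_indicator hs]
  congr 1
  funext x
  by_cases hx : x ∈ s <;> simp [hx]

variable {X : Type*} [mX : MeasurableSpace X]

theorem condExp_aeInv_comp {μ : Measure X} [IsFiniteMeasure μ] {T T₁ T₂ : X → X}
    (hT : MeasurePreserving T μ μ)
    (hinv : ∀ s, MeasurableSet[aeInv μ T₁ T₂] s → T ⁻¹' s =ᵐ[μ] s) {f : X → ℝ} (hf : BddMeas f) :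
    μ[fun x => f (T x)|aeInv μ T₁ T₂] =ᵐ[μ] μ[f|aeInv μ T₁ T₂] := by
  refine (ae_eq_condExp_of_forall_setIntegral_eq (aeInv_le μ T₁ T₂)
    (hf.comp hT.measurable).integrable (fun s _ _ => integrable_condExp.integrableOn)
    (fun s hs _ => ?_) stronglyMeasurable_condExp.aestronglyMeasurable).symm
  rw [setIntegral_condExp (aeInv_le μ T₁ T₂) hf.integrable hs,
    ← integral_mul_indicator_one hs.1, ← integral_mul_indicator_one hs.1,
    hf.integral_comp_mul hT (.indicator_one hs.1) (ae_indicator_comp (hinv s hs))]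

/-- A version of the condition for ergodicity which only involves a generating `π`-system. -/
theorem measure_eq_zero_or_one_of_ergAvg {lam : Measure X} [IsProbabilityMeasure lam]
    {T₁ T₂ : X → X} (h₁ : MeasurePreserving T₁ lam lam) (h₂ : MeasurePreserving T₂ lam lam)
    {𝒜 : Set (Set X)} (hgen : mX = MeasurableSpace.generateFrom 𝒜) (hpi : IsPiSystem 𝒜)
    (H : ∀ A ∈ 𝒜, ∀ ε > 0, ∃ N ≠ 0,
      ∫ y, (ergAvg T₁ T₂ N (A.indicator fun _ => 1) y - lam.real A) ^ 2 ∂lam < ε)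
    {B : Set X} (hB : MeasurableSet B) (hB₁ : T₁ ⁻¹' B =ᵐ[lam] B) (hB₂ : T₂ ⁻¹' B =ᵐ[lam] B) :
    lam B = 0 ∨ lam B = 1 := by
  have hA : ∀ A ∈ 𝒜, lam.real (A ∩ B) = lam.real A * lam.real B := by
    intro A hA
    have hAm : MeasurableSet A := hgen ▸ MeasurableSpace.measurableSet_generateFrom hA
    have hAf : BddMeas (A.indicator fun _ => (1 : ℝ)) := .indicator_one hAm
    have hBf : BddMeas (B.indicator fun _ => (1 : ℝ)) := .indicator_one hB
    refine eq_of_forall_dist_le fun ε hε => ?_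
    obtain ⟨N, hN, hlt⟩ := H A hA (ε ^ 2) (by positivity)
    set u : X → ℝ := fun y => ergAvg T₁ T₂ N (A.indicator fun _ => 1) y - lam.real A with hu
    have hub : BddMeas u := (hAf.ergAvg h₁.measurable h₂.measurable N).sub (.const _)
    have hBi : ∫ y, B.indicator (fun _ => (1 : ℝ)) y ∂lam = lam.real B := by
      rw [integral_indicator hB]; simp
    have e1 : ∫ y, u y * B.indicator (fun _ => (1 : ℝ)) y ∂lam =
        lam.real (A ∩ B) - lam.real A * lam.real B := by
      have : ∀ y, u y * B.indicator (fun _ => (1 : ℝ)) y =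
          ergAvg T₁ T₂ N (A.indicator fun _ => 1) y * B.indicator (fun _ => (1 : ℝ)) y -
            lam.real A * B.indicator (fun _ => (1 : ℝ)) y := fun y => by rw [hu]; ring
      simp_rw [this]
      rw [((hAf.ergAvg h₁.measurable h₂.measurable N).mul hBf).integral_sub
        ((BddMeas.const _).mul hBf),
        integral_ergAvg_mul h₁ h₂ hAf hBf (ae_indicator_comp hB₁) (ae_indicator_comp hB₂) hN,
        integral_const_mul, integral_mul_indicator_one hB, hBi]
      have : ∫ x in B, A.indicator (fun _ => (1 : ℝ)) x ∂lam = lam.real (A ∩ B) := by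
        rw [setIntegral_indicator hAm, Set.inter_comm]
        simp
      rw [this]
    have e2 := hub.sq_integral_mul_le hBf lam
    have e3 : ∫ y, B.indicator (fun _ => (1 : ℝ)) y * B.indicator (fun _ => (1 : ℝ)) y ∂lam ≤
        1 := by
      rw [integral_mul_indicator_one hB, setIntegral_indicator hB]
      simp
    simp only [pow_two] at hlt
    have e4 : 0 ≤ ∫ y, u y * u y ∂lam := integral_nonneg fun y => mul_self_nonneg _
    rw [Real.dist_eq, ← e1]
    refine abs_le_of_sq_le_sq (e2.trans ?_) hε.le
    nlinarith
  have hmeas : ∀ D, MeasurableSet D → lam (D ∩ B) = lam D * lam B := by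
    have : lam.restrict B = lam B • lam := by
      refine ext_of_generate_finite 𝒜 hgen hpi (fun A hA' => ?_) (by simp)
      have hAm : MeasurableSet A := hgen ▸ MeasurableSpace.measurableSet_generateFrom hA'
      have := hA A hA'
      rw [Measure.restrict_apply hAm, Measure.smul_apply, smul_eq_mul]
      simp only [Measure.real] at this
      rw [← ENNReal.toReal_mul, ENNReal.toReal_eq_toReal_iff' (measure_ne_top _ _)
        (ENNReal.mul_ne_top (measure_ne_top _ _) (measure_ne_top _ _))] at this
      rw [this, mul_comm]
    intro D hD
    rw [← Measure.restrict_apply hD, this, Measure.smul_apply, smul_eq_mul, mul_comm]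
  have := hmeas B hB
  rw [Set.inter_self] at this
  by_cases h0 : lam B = 0
  · exact Or.inl h0
  · right
    have h2 : lam B * 1 = lam B * lam B := by rw [mul_one]; exact this
    exact ((ENNReal.mul_right_inj h0 (measure_ne_top _ _)).1 h2).symm

variable [StandardBorelSpace X]

/-- The disintegration of a measure over its σ-algebra of invariant sets. -/
noncomputable def invKernel (μ : Measure X) [IsFiniteMeasure μ] (T₁ T₂ : X → X) : Kernel X X :=
  (condExpKernel μ (aeInv μ T₁ T₂)).comap id (measurable_id'' (aeInv_le μ T₁ T₂))

section

variable {μ : Measure X} [IsFiniteMeasure μ] {T₁ T₂ : X → X}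

instance : IsMarkovKernel (invKernel μ T₁ T₂) := by
  unfold invKernel; infer_instance

theorem BddMeas.condExp_ae_eq {f : X → ℝ} (hf : BddMeas f) :
    μ[f|aeInv μ T₁ T₂] =ᵐ[μ] fun x => ∫ y, f y ∂invKernel μ T₁ T₂ x :=
  condExp_ae_eq_integral_condExpKernel (aeInv_le μ T₁ T₂) hf.integrable

theorem BddMeas.measurable_invKernel {f : X → ℝ} (hf : BddMeas f) :
    Measurable[aeInv μ T₁ T₂] fun x => ∫ y, f y ∂invKernel μ T₁ T₂ x :=
  hf.1.stronglyMeasurable.integral_condExpKernel.measurable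

omit [StandardBorelSpace X] in
theorem BddMeas.integral_kernel {Y : Type*} [MeasurableSpace Y] {κ : Kernel Y X} [IsMarkovKernel κ]
    {f : Y × X → ℝ} (hf : BddMeas f) : BddMeas fun x => ∫ y, f (x, y) ∂κ x := by
  obtain ⟨hf, C, hC⟩ := hf
  refine ⟨(hf.stronglyMeasurable.integral_kernel_prod_right').measurable, C, fun x => ?_⟩
  have := norm_integral_le_of_norm_le_const (μ := κ x) (f := fun y => f (x, y)) (C := C)
    (ae_of_all _ fun y => hC (x, y))
  simpa using this

theorem BddMeas.invKernel {f : X → ℝ} (hf : BddMeas f) :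
    BddMeas fun x => ∫ y, f y ∂invKernel μ T₁ T₂ x :=
  (hf.comp measurable_snd).integral_kernel

theorem integral_invKernel_mul {f w : X → ℝ} (hf : BddMeas f) (hw : BddMeas w)
    (hwm : Measurable[aeInv μ T₁ T₂] w) :
    ∫ x, (∫ y, f y ∂invKernel μ T₁ T₂ x) * w x ∂μ = ∫ x, f x * w x ∂μ := by
  rw [← integral_condExp (aeInv_le μ T₁ T₂) (f := fun x => f x * w x)]
  refine integral_congr_ae ?_
  have := condExp_mul_of_stronglyMeasurable_right (f := f) (g := w) (μ := μ)
    hwm.stronglyMeasurable (hf.mul hw).integrable hf.integrable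
  filter_upwards [this, hf.condExp_ae_eq (μ := μ) (T₁ := T₁) (T₂ := T₂)] with x h1 h2
  exact (h1.trans (by rw [Pi.mul_apply, h2])).symm

theorem integral_integral_invKernel {f : X → ℝ} (hf : BddMeas f) :
    ∫ x, (∫ y, f y ∂invKernel μ T₁ T₂ x) ∂μ = ∫ x, f x ∂μ := by
  simpa using integral_invKernel_mul (μ := μ) (T₁ := T₁) (T₂ := T₂) hf (.const 1)
    measurable_const

theorem integral_sq_sub_invKernel {f w : X → ℝ} (hf : BddMeas f) (hw : BddMeas w)
    (hwm : Measurable[aeInv μ T₁ T₂] w) :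
    ∫ x, (∫ y, (f y - w x) * (f y - w x) ∂invKernel μ T₁ T₂ x) ∂μ =
      ∫ x, (f x - w x) * (f x - w x) ∂μ := by
  have e : ∀ x, ∫ y, (f y - w x) * (f y - w x) ∂invKernel μ T₁ T₂ x =
      ∫ y, f y * f y ∂invKernel μ T₁ T₂ x - 2 * ((∫ y, f y ∂invKernel μ T₁ T₂ x) * w x) +
        w x * w x := by
    intro x
    have : ∀ y, (f y - w x) * (f y - w x) = f y * f y - (2 * w x) * f y + w x * w x :=
      fun y => by ring
    simp_rw [this]
    rw [((hf.mul hf).sub ((BddMeas.const _).mul hf)).integral_add (.const _),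
      (hf.mul hf).integral_sub ((BddMeas.const _).mul hf), integral_const_mul]
    simp
    ring
  have e' : ∀ x, (f x - w x) * (f x - w x) = f x * f x - 2 * (f x * w x) + w x * w x :=
    fun x => by ring
  simp_rw [e, e']
  rw [((hf.mul hf).invKernel.sub ((BddMeas.const _).mul (hf.invKernel.mul hw))).integral_add
    (hw.mul hw), (hf.mul hf).invKernel.integral_sub ((BddMeas.const _).mul (hf.invKernel.mul hw)),
    ((hf.mul hf).sub ((BddMeas.const _).mul (hf.mul hw))).integral_add
    (hw.mul hw), (hf.mul hf).integral_sub ((BddMeas.const _).mul (hf.mul hw)),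
    integral_const_mul, integral_const_mul, integral_invKernel_mul hf hw hwm,
    integral_integral_invKernel (hf.mul hf)]

theorem invKernel_comp_ae {T : X → X} (hT : MeasurePreserving T μ μ)
    (hinv : ∀ s, MeasurableSet[aeInv μ T₁ T₂] s → T ⁻¹' s =ᵐ[μ] s) :
    ∀ᵐ x ∂μ, MeasurePreserving T (invKernel μ T₁ T₂ x) (invKernel μ T₁ T₂ x) := by
  set 𝒜 := generateSetAlgebra (MeasurableSpace.countableGeneratingSet X)
  have hc : 𝒜.Countable :=
    countable_generateSetAlgebra MeasurableSpace.countable_countableGeneratingSet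
  have hgen : mX = MeasurableSpace.generateFrom 𝒜 := by
    rw [generateFrom_generateSetAlgebra_eq, MeasurableSpace.generateFrom_countableGeneratingSet]
  have key : ∀ A ∈ 𝒜, ∀ᵐ x ∂μ, invKernel μ T₁ T₂ x (T ⁻¹' A) = invKernel μ T₁ T₂ x A := by
    intro A hA
    have hAm : MeasurableSet A := hgen ▸ MeasurableSpace.measurableSet_generateFrom hA
    have hAf : BddMeas (A.indicator fun _ => (1 : ℝ)) := .indicator_one hAm
    filter_upwards [condExp_aeInv_comp hT hinv hAf,
      hAf.condExp_ae_eq (μ := μ) (T₁ := T₁) (T₂ := T₂),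
      (hAf.comp hT.measurable).condExp_ae_eq (μ := μ) (T₁ := T₁) (T₂ := T₂)] with x e1 e2 e3
    have e4 : (fun y => A.indicator (fun _ => (1 : ℝ)) (T y)) =
      (T ⁻¹' A).indicator fun _ => (1 : ℝ) := rfl
    rw [e2, e3, e4, integral_indicator hAm, integral_indicator (hT.measurable hAm)] at e1
    simpa [Measure.real, ENNReal.toReal_eq_toReal_iff' (measure_ne_top _ _) (measure_ne_top _ _)]
      using e1
  filter_upwards [(ae_ball_iff hc).2 key] with x hx
  refine ⟨hT.measurable, ?_⟩
  refine ext_of_generate_finite 𝒜 hgen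
    isSetAlgebra_generateSetAlgebra.isSetRing.isSetSemiring.isPiSystem (fun A hA => ?_) ?_
  · have hAm : MeasurableSet A := hgen ▸ MeasurableSpace.measurableSet_generateFrom hA
    rw [Measure.map_apply hT.measurable hAm, hx A hA]
  · rw [Measure.map_apply hT.measurable MeasurableSet.univ, Set.preimage_univ]

/-- The disintegration over the σ-algebra of invariant sets consists of invariant ergodic
measures. -/
theorem invKernel_ergodic (h₁ : MeasurePreserving T₁ μ μ) (h₂ : MeasurePreserving T₂ μ μ) :
    ∀ᵐ x ∂μ, MeasurePreserving T₁ (invKernel μ T₁ T₂ x) (invKernel μ T₁ T₂ x) ∧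
      MeasurePreserving T₂ (invKernel μ T₁ T₂ x) (invKernel μ T₁ T₂ x) ∧
      ∀ B, MeasurableSet B → T₁ ⁻¹' B =ᵐ[invKernel μ T₁ T₂ x] B →
        T₂ ⁻¹' B =ᵐ[invKernel μ T₁ T₂ x] B →
        invKernel μ T₁ T₂ x B = 0 ∨ invKernel μ T₁ T₂ x B = 1 := by
  set 𝒜 := generateSetAlgebra (MeasurableSpace.countableGeneratingSet X)
  have hc : 𝒜.Countable :=
    countable_generateSetAlgebra MeasurableSpace.countable_countableGeneratingSet
  have hgen : mX = MeasurableSpace.generateFrom 𝒜 := by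
    rw [generateFrom_generateSetAlgebra_eq, MeasurableSpace.generateFrom_countableGeneratingSet]
  have hlim : ∀ f : X → ℝ, BddMeas f → ∀ k : ℕ, ∀ᵐ x ∂μ, ∃ N ≠ 0,
      ∫ y, (ergAvg T₁ T₂ N f y - ∫ z, f z ∂invKernel μ T₁ T₂ x) ^ 2 ∂invKernel μ T₁ T₂ x <
        1 / ((k : ℝ) + 1) := by
    intro f hf k
    set w : X → ℝ := fun x => ∫ z, f z ∂invKernel μ T₁ T₂ x with hw
    set G : ℕ → X → ℝ := fun N x =>
      ∫ y, (ergAvg T₁ T₂ N f y - w x) * (ergAvg T₁ T₂ N f y - w x) ∂invKernel μ T₁ T₂ x with hG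
    have hGb : ∀ N, BddMeas (G N) := fun N => by
      have h := ((hf.ergAvg h₁.measurable h₂.measurable N).comp
        (measurable_snd (α := X))).sub
        ((hf.invKernel (μ := μ) (T₁ := T₁) (T₂ := T₂)).comp measurable_fst)
      exact (h.mul h).integral_kernel
    have hG0 : ∀ N x, 0 ≤ G N x := fun N x => integral_nonneg fun y => mul_self_nonneg _
    have hGlim : Tendsto (fun N => ∫ x, G N x ∂μ) atTop (𝓝 0) := by
      refine (tendsto_ergAvg h₁ h₂ hf).congr fun N => ?_
      rw [integral_sq_sub_invKernel (hf.ergAvg h₁.measurable h₂.measurable N) hf.invKernel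
        hf.measurable_invKernel]
      refine integral_congr_ae ?_
      filter_upwards [hf.condExp_ae_eq (μ := μ) (T₁ := T₁) (T₂ := T₂)] with x hx
      rw [hx, pow_two]
    have hε : (0 : ℝ) < 1 / ((k : ℝ) + 1) := by positivity
    have hS : ∀ N ≠ 0, 1 / ((k : ℝ) + 1) * μ.real {x | ∀ N ≠ 0, 1 / ((k : ℝ) + 1) ≤ G N x} ≤
        ∫ x, G N x ∂μ := by
      intro N hN
      refine le_trans (mul_le_mul_of_nonneg_left (measureReal_mono fun x hx => hx N hN) hε.le)
        (mul_meas_ge_le_integral_of_nonneg (ae_of_all _ (hG0 N)) (hGb N).integrable _)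
    have hle := ge_of_tendsto hGlim ((eventually_ne_atTop 0).mono hS)
    have h0 : μ.real {x | ∀ N ≠ 0, 1 / ((k : ℝ) + 1) ≤ G N x} = 0 :=
      le_antisymm (by
        by_contra! hcon
        exact absurd hle (not_le.2 (mul_pos hε hcon))) measureReal_nonneg
    rw [measureReal_eq_zero_iff] at h0
    rw [ae_iff]
    refine measure_mono_null (fun x hx => ?_) h0
    simp only [Set.mem_ofPred_eq, not_exists, not_and, not_lt] at hx ⊢
    intro N hN
    simpa [hG, pow_two] using hx N hN
  have hall : ∀ᵐ x ∂μ, ∀ A ∈ 𝒜, ∀ k : ℕ, ∃ N ≠ 0,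
      ∫ y, (ergAvg T₁ T₂ N (A.indicator fun _ => 1) y -
        ∫ z, A.indicator (fun _ => (1 : ℝ)) z ∂invKernel μ T₁ T₂ x) ^ 2 ∂invKernel μ T₁ T₂ x <
        1 / ((k : ℝ) + 1) := by
    refine (ae_ball_iff hc).2 fun A hA => ae_all_iff.2 fun k => hlim _ (.indicator_one ?_) k
    exact hgen ▸ MeasurableSpace.measurableSet_generateFrom hA
  filter_upwards [hall, invKernel_comp_ae h₁ fun s hs => hs.2.1,
    invKernel_comp_ae h₂ fun s hs => hs.2.2] with x hx hx1 hx2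
  refine ⟨hx1, hx2, fun B hB hB₁ hB₂ => ?_⟩
  refine measure_eq_zero_or_one_of_ergAvg hx1 hx2 hgen
    isSetAlgebra_generateSetAlgebra.isSetRing.isSetSemiring.isPiSystem
    (fun A hA ε hε => ?_) hB hB₁ hB₂
  have hAm : MeasurableSet A := hgen ▸ MeasurableSpace.measurableSet_generateFrom hA
  obtain ⟨k, hk⟩ := exists_nat_one_div_lt hε
  obtain ⟨N, hN, h⟩ := hx A hA k
  rw [integral_indicator hAm, setIntegral_const, smul_eq_mul, mul_one] at h
  exact ⟨N, hN, h.trans hk⟩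

end

end ErgodicDecomposition

section RelativeSquare

open ProbabilityTheory

theorem Measure.ext_of_integral_indicator_mul {X Y : Type*} [MeasurableSpace X] [MeasurableSpace Y]
    {m m' : Measure (X × Y)} [IsFiniteMeasure m] [IsFiniteMeasure m']
    (h : ∀ (f : X → ℝ) (g : Y → ℝ), BddMeas f → BddMeas g →
      ∫ p, f p.1 * g p.2 ∂m = ∫ p, f p.1 * g p.2 ∂m') : m = m' := by
  refine Measure.ext_prod fun {s t} hs ht => ?_
  have h1 := h _ _ (.indicator_one hs) (.indicator_one ht)
  have h2 : (fun p : X × Y => s.indicator (fun _ => (1 : ℝ)) p.1 * t.indicator (fun _ => 1) p.2) =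
      (s ×ˢ t).indicator fun _ => (1 : ℝ) := by
    funext p
    by_cases hp : p.1 ∈ s <;> by_cases hq : p.2 ∈ t <;> simp [hp, hq, Set.indicator]
  rw [h2, integral_indicator (hs.prod ht), integral_indicator (hs.prod ht)] at h1
  simpa [Measure.real, ENNReal.toReal_eq_toReal_iff' (measure_ne_top _ _) (measure_ne_top _ _)]
    using h1

variable {X : Type*} [mX : MeasurableSpace X] [StandardBorelSpace X]

/-- The relatively independent self-joining of `μ` over the `T`-invariant sets. -/
noncomputable def relSq (μ : Measure X) [IsFiniteMeasure μ] (T : X → X) : Measure (X × X) :=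
  μ ⊗ₘ invKernel μ T T

variable {μ : Measure X} [IsProbabilityMeasure μ] {T : X → X}

instance : IsProbabilityMeasure (relSq μ T) := by
  unfold relSq; infer_instance

theorem integral_relSq {F : X × X → ℝ} (hF : BddMeas F) :
    ∫ p, F p ∂relSq μ T = ∫ x, ∫ y, F (x, y) ∂invKernel μ T T x ∂μ :=
  Measure.integral_compProd hF.integrable

theorem integral_relSq_mul {f g : X → ℝ} (hf : BddMeas f) (hg : BddMeas g) :
    ∫ p, f p.1 * g p.2 ∂relSq μ T = ∫ x, f x * ∫ y, g y ∂invKernel μ T T x ∂μ := by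
  rw [integral_relSq ((hf.comp measurable_fst).mul (hg.comp measurable_snd))]
  simp_rw [integral_const_mul]

theorem integral_relSq_mul' {f g : X → ℝ} (hf : BddMeas f) (hg : BddMeas g) :
    ∫ p, f p.1 * g p.2 ∂relSq μ T =
      ∫ x, (∫ y, f y ∂invKernel μ T T x) * ∫ y, g y ∂invKernel μ T T x ∂μ := by
  rw [integral_relSq_mul hf hg, integral_invKernel_mul hf hg.invKernel hg.measurable_invKernel]

theorem integral_relSq_mul_comm {f g : X → ℝ} (hf : BddMeas f) (hg : BddMeas g) :
    ∫ p, f p.1 * g p.2 ∂relSq μ T = ∫ p, g p.1 * f p.2 ∂relSq μ T := by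
  rw [integral_relSq_mul' hf hg, integral_relSq_mul' hg hf]
  simp_rw [mul_comm]

theorem sq_integral_relSq_mul_le {f g : X → ℝ} (hf : BddMeas f) (hg : BddMeas g) :
    (∫ p, f p.1 * g p.2 ∂relSq μ T) ^ 2 ≤
      (∫ p, f p.1 * f p.2 ∂relSq μ T) * ∫ p, g p.1 * g p.2 ∂relSq μ T := by
  rw [integral_relSq_mul' hf hg, integral_relSq_mul' hf hf, integral_relSq_mul' hg hg]
  exact hf.invKernel.sq_integral_mul_le hg.invKernel μ

theorem measurePreserving_fst_relSq : MeasurePreserving Prod.fst (relSq μ T) μ :=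
  ⟨measurable_fst, Measure.fst_compProd _ _⟩

theorem tendsto_relSq (hT : MeasurePreserving T μ μ) {f g : X → ℝ} (hf : BddMeas f)
    (hg : BddMeas g) :
    Tendsto (fun N : ℕ => (∑ n ∈ Finset.range N, ∫ x, f x * g (T^[n] x) ∂μ) / (N : ℝ)) atTop
      (𝓝 (∫ p, f p.1 * g p.2 ∂relSq μ T)) := by
  have hA : ∀ N, BddMeas fun x => ergAvg T T N g x - ∫ y, g y ∂invKernel μ T T x := fun N =>
    (hg.ergAvg hT.measurable hT.measurable N).sub hg.invKernel
  have hlim : Tendsto (fun N => (∫ x, f x * f x ∂μ) *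
      ∫ x, (ergAvg T T N g x - ∫ y, g y ∂invKernel μ T T x) *
        (ergAvg T T N g x - ∫ y, g y ∂invKernel μ T T x) ∂μ) atTop (𝓝 0) := by
    have := (tendsto_ergAvg hT hT hg).const_mul (∫ x, f x * f x ∂μ)
    rw [mul_zero] at this
    refine this.congr fun N => ?_
    congr 1
    refine integral_congr_ae ?_
    filter_upwards [hg.condExp_ae_eq (μ := μ) (T₁ := T) (T₂ := T)] with x hx
    rw [hx, pow_two]
  have h0 : Tendsto (fun N => ∫ x, f x * (ergAvg T T N g x - ∫ y, g y ∂invKernel μ T T x) ∂μ)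
      atTop (𝓝 0) := by
    have h1 : Tendsto (fun N =>
        (∫ x, f x * (ergAvg T T N g x - ∫ y, g y ∂invKernel μ T T x) ∂μ) ^ 2) atTop (𝓝 0) :=
      squeeze_zero (fun N => sq_nonneg _) (fun N => hf.sq_integral_mul_le (hA N) μ) hlim
    have h2 := h1.sqrt
    simp only [Real.sqrt_sq_eq_abs, Real.sqrt_zero] at h2
    exact (tendsto_zero_iff_abs_tendsto_zero _).2 h2
  have h1 := h0.add_const (∫ p, f p.1 * g p.2 ∂relSq μ T)
  rw [zero_add] at h1
  refine h1.congr fun N => ?_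
  rw [integral_relSq_mul hf hg]
  simp_rw [mul_sub]
  rw [(hf.mul (hg.ergAvg hT.measurable hT.measurable N)).integral_sub (hf.mul hg.invKernel),
    sub_add_cancel]
  simp only [ergAvg, avgOp_self_iterate, mul_div_assoc', Finset.mul_sum]
  rw [integral_div, integral_finsetSum]
  exact fun n _ => (hf.mul (hg.comp (hT.measurable.iterate n))).integrable

theorem integral_comp_relSq_eq (hT : MeasurePreserving T μ μ) {f g f' g' : X → ℝ} (hf : BddMeas f)
    (hg : BddMeas g) (hf' : BddMeas f') (hg' : BddMeas g')
    (h : ∀ n, ∫ x, f x * g (T^[n] x) ∂μ = ∫ x, f' x * g' (T^[n] x) ∂μ) :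
    ∫ p, f p.1 * g p.2 ∂relSq μ T = ∫ p, f' p.1 * g' p.2 ∂relSq μ T :=
  tendsto_nhds_unique (tendsto_relSq hT hf hg)
    ((tendsto_relSq hT hf' hg').congr fun N => by simp_rw [h])

omit [StandardBorelSpace X] in
theorem measurePreserving_of_integral_mul {R R' : X → X} {m : Measure (X × X)} [IsFiniteMeasure m]
    (hR : Measurable R) (hR' : Measurable R')
    (h : ∀ f g : X → ℝ, BddMeas f → BddMeas g →
      ∫ p, f (R p.1) * g (R' p.2) ∂m = ∫ p, f p.1 * g p.2 ∂m) :
    MeasurePreserving (Prod.map R R') m m := by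
  have hm : Measurable (Prod.map R R') := hR.prodMap hR'
  refine ⟨hm, ?_⟩
  refine Measure.ext_of_integral_indicator_mul fun f g hf hg => ?_
  rw [integral_map hm.aemeasurable
    ((hf.comp measurable_fst).mul (hg.comp measurable_snd)).1.aestronglyMeasurable]
  exact h f g hf hg

theorem measurePreserving_prodMap_relSq (hT : MeasurePreserving T μ μ) {R : X → X}
    (hR : MeasurePreserving R μ μ) (hRT : ∀ x, R (T x) = T (R x)) :
    MeasurePreserving (Prod.map R R) (relSq μ T) (relSq μ T) := by
  refine measurePreserving_of_integral_mul hR.measurable hR.measurable fun f g hf hg => ?_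
  refine integral_comp_relSq_eq hT (hf.comp hR.measurable) (hg.comp hR.measurable) hf hg
    fun n => ?_
  have hn : ∀ x, R (T^[n] x) = T^[n] (R x) :=
    Function.Semiconj.iterate_right (f := R) (ga := T) (gb := T) hRT n
  simp_rw [hn]
  exact (hf.mul (hg.comp (hT.measurable.iterate n))).integral_comp hR

theorem measurePreserving_id_prodMap_relSq (hT : MeasurePreserving T μ μ) :
    MeasurePreserving (Prod.map id T) (relSq μ T) (relSq μ T) := by
  refine measurePreserving_of_integral_mul measurable_id hT.measurable fun f g hf hg => ?_
  have h := hg.comp hT.measurable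
  refine (integral_relSq_mul (f := fun x => f (id x)) hf h).trans ?_
  rw [integral_relSq_mul hf hg]
  refine integral_congr_ae ?_
  filter_upwards [hg.condExp_ae_eq (μ := μ) (T₁ := T) (T₂ := T),
    h.condExp_ae_eq (μ := μ) (T₁ := T) (T₂ := T),
    condExp_aeInv_comp (T₁ := T) (T₂ := T) hT (fun s hs => hs.2.1) hg] with x h1 h2 h3
  rw [← h1, ← h2, h3, id]

theorem measurePreserving_prodMap_id_relSq (hT : MeasurePreserving T μ μ) :
    MeasurePreserving (Prod.map T id) (relSq μ T) (relSq μ T) := by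
  refine measurePreserving_of_integral_mul hT.measurable measurable_id fun f g hf hg => ?_
  have h := hf.comp hT.measurable
  refine (integral_relSq_mul_comm (g := fun x => g (id x)) h hg).trans ?_
  rw [integral_relSq_mul_comm hf hg]
  exact (hg.comp (measurable_fst (β := X))).mul (hf.comp measurable_snd) |>.integral_comp
    (measurePreserving_id_prodMap_relSq hT)

/-- A function on the relative square which is invariant under `T` in the second coordinate
only depends on the first coordinate. -/
theorem ae_eq_integral_invKernel_of_comp_ae_eq (hT : MeasurePreserving T μ μ) {Φ : X × X → ℝ}
    (hΦ : BddMeas Φ) (h : ∀ᵐ p ∂relSq μ T, Φ (p.1, T p.2) = Φ p) :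
    ∀ᵐ p ∂relSq μ T, Φ p = ∫ y, Φ (p.1, y) ∂invKernel μ T T p.1 := by
  have hm : MeasurableSet {p : X × X | Φ p = ∫ y, Φ (p.1, y) ∂invKernel μ T T p.1} :=
    measurableSet_eq_fun hΦ.1 ((hΦ.integral_kernel (κ := invKernel μ T T)).1.comp measurable_fst)
  refine (Measure.ae_compProd_iff hm).2 ?_
  filter_upwards [Measure.ae_ae_of_ae_compProd h, invKernel_ergodic (μ := μ) hT hT]
    with x hx ⟨hx1, _, hx2⟩
  have herg : Ergodic T (invKernel μ T T x) := by
    refine ⟨hx1, ⟨fun s hs hst => ?_⟩⟩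
    have := hx2 s hs hst.eventuallyEq hst.eventuallyEq
    rw [eventuallyConst_set']
    rcases this with h0 | h1
    · exact Or.inl (ae_eq_empty.2 h0)
    · exact Or.inr ((ae_eq_univ_iff_measure_eq hs.nullMeasurableSet).2 (by rw [h1, measure_univ]))
  obtain ⟨c, hc⟩ := herg.ae_eq_const_of_ae_eq_comp_ae (g := fun y => Φ (x, y))
    (hΦ.1.comp measurable_prodMk_left).aestronglyMeasurable hx
  have : ∫ y, Φ (x, y) ∂invKernel μ T T x = c := by
    rw [integral_congr_ae hc]; simp
  simp only [this]
  exact hc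

end RelativeSquare

section BoxForm

/-- Two commuting measure-preserving maps. -/
structure CommPair {X : Type*} [MeasurableSpace X] (μ : Measure X) (T₁ T₂ : X → X) : Prop where
  left : MeasurePreserving T₁ μ μ
  right : MeasurePreserving T₂ μ μ
  comm : ∀ x, T₁ (T₂ x) = T₂ (T₁ x)

theorem HasBoxAvg.unique {X : Type*} [MeasurableSpace X] {μ : Measure X} {T₁ T₂ : X → X}
    {f : X → ℝ} {L L' : ℝ} (h : HasBoxAvg μ T₁ T₂ f L) (h' : HasBoxAvg μ T₁ T₂ f L') : L = L' := by
  obtain ⟨c, hc, hL⟩ := h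
  obtain ⟨c', hc', hL'⟩ := h'
  obtain rfl : c = c' := funext fun n => tendsto_nhds_unique (hc n) (hc' n)
  exact tendsto_nhds_unique hL hL'

theorem HasBoxAvg.comp {X Y : Type*} [MeasurableSpace X] [MeasurableSpace Y] {μ : Measure X}
    {ν : Measure Y} {T₁ T₂ : X → X} {S₁ S₂ : Y → Y} {p : Y → X} (hp : MeasurePreserving p ν μ)
    (hT₁ : Measurable T₁) (hT₂ : Measurable T₂)
    (h₁ : ∀ y, p (S₁ y) = T₁ (p y)) (h₂ : ∀ y, p (S₂ y) = T₂ (p y)) {f : X → ℝ} (hf : BddMeas f)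
    {L : ℝ} (h : HasBoxAvg μ T₁ T₂ f L) : HasBoxAvg ν S₁ S₂ (fun y => f (p y)) L := by
  obtain ⟨c, hc, hL⟩ := h
  refine ⟨c, fun n => (hc n).congr fun N => ?_, hL⟩
  congr 1
  refine Finset.sum_congr rfl fun m _ => ?_
  have e₁ : ∀ k y, p (S₁^[k] y) = T₁^[k] (p y) := fun k => Function.Semiconj.iterate_right h₁ k
  have e₂ : ∀ k y, p (S₂^[k] y) = T₂^[k] (p y) := fun k => Function.Semiconj.iterate_right h₂ k
  simp_rw [e₁, e₂]
  exact ((((hf.mul (hf.comp (hT₁.iterate m))).mul (hf.comp (hT₂.iterate n))).mul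
    (hf.comp ((hT₁.iterate m).comp (hT₂.iterate n)))).integral_comp hp).symm

variable {X : Type*} [mX : MeasurableSpace X] [StandardBorelSpace X]

theorem CommPair.prodMap {μ : Measure X} [IsProbabilityMeasure μ] {T₁ T₂ : X → X}
    (h : CommPair μ T₁ T₂) :
    MeasurePreserving (Prod.map T₂ T₂) (relSq μ T₁) (relSq μ T₁) :=
  measurePreserving_prodMap_relSq h.left h.right fun x => (h.comm x).symm

/-- The box measure of a pair of maps. -/
noncomputable def boxMeas (μ : Measure X) [IsProbabilityMeasure μ] (T₁ T₂ : X → X) :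
    Measure ((X × X) × (X × X)) :=
  relSq (relSq μ T₁) (Prod.map T₂ T₂)

/-- The correlations whose averages converge to the box form. -/
noncomputable def boxCorr (μ : Measure X) [IsProbabilityMeasure μ] (T₁ T₂ : X → X)
    (f₀ f₁ f₂ f₃ : X → ℝ) (n : ℕ) : ℝ :=
  ∫ p, (f₀ p.1 * f₂ (T₂^[n] p.1)) * (f₁ p.2 * f₃ (T₂^[n] p.2)) ∂relSq μ T₁

/-- The four-linear form associated to the box measure. -/
noncomputable def boxForm (μ : Measure X) [IsProbabilityMeasure μ] (T₁ T₂ : X → X)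
    (f₀ f₁ f₂ f₃ : X → ℝ) : ℝ :=
  ∫ p, (f₀ p.1.1 * f₁ p.1.2) * (f₂ p.2.1 * f₃ p.2.2) ∂boxMeas μ T₁ T₂

variable {μ : Measure X} [IsProbabilityMeasure μ] {T₁ T₂ : X → X}

instance : IsProbabilityMeasure (boxMeas μ T₁ T₂) := by
  unfold boxMeas; infer_instance

theorem tendsto_boxCorr (h : CommPair μ T₁ T₂) {f₀ f₁ f₂ f₃ : X → ℝ} (h₀ : BddMeas f₀)
    (h₁ : BddMeas f₁) (h₂ : BddMeas f₂) (h₃ : BddMeas f₃) (n : ℕ) :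
    Tendsto (fun N : ℕ => (∑ m ∈ Finset.range N,
      ∫ x, f₀ x * f₁ (T₁^[m] x) * f₂ (T₂^[n] x) * f₃ (T₁^[m] (T₂^[n] x)) ∂μ) / (N : ℝ)) atTop
      (𝓝 (boxCorr μ T₁ T₂ f₀ f₁ f₂ f₃ n)) := by
  have hn := h.right.measurable.iterate n
  refine (tendsto_relSq h.left (h₀.mul (h₂.comp hn)) (h₁.mul (h₃.comp hn))).congr fun N => ?_
  congr 1
  refine Finset.sum_congr rfl fun m _ => ?_
  have : ∀ x, T₁^[m] (T₂^[n] x) = T₂^[n] (T₁^[m] x) := fun x =>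
    Function.Commute.iterate_iterate (f := T₁) (g := T₂) h.comm m n x
  simp_rw [this]
  congr 1
  funext x
  ring

theorem tendsto_boxForm (h : CommPair μ T₁ T₂) {f₀ f₁ f₂ f₃ : X → ℝ} (h₀ : BddMeas f₀)
    (h₁ : BddMeas f₁) (h₂ : BddMeas f₂) (h₃ : BddMeas f₃) :
    Tendsto (fun N : ℕ => (∑ n ∈ Finset.range N, boxCorr μ T₁ T₂ f₀ f₁ f₂ f₃ n) / (N : ℝ)) atTop
      (𝓝 (boxForm μ T₁ T₂ f₀ f₁ f₂ f₃)) := by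
  refine (tendsto_relSq h.prodMap
    ((h₀.comp (measurable_fst (β := X))).mul (h₁.comp measurable_snd))
    ((h₂.comp (measurable_fst (β := X))).mul (h₃.comp measurable_snd))).congr fun N => ?_
  congr 1
  refine Finset.sum_congr rfl fun n _ => ?_
  simp only [boxCorr, Prod.map_iterate, Prod.map_fst, Prod.map_snd]
  congr 1
  funext p
  ring

theorem hasBoxAvg_boxForm (h : CommPair μ T₁ T₂) {f : X → ℝ} (hf : BddMeas f) :
    HasBoxAvg μ T₁ T₂ f (boxForm μ T₁ T₂ f f f f) :=
  ⟨boxCorr μ T₁ T₂ f f f f, tendsto_boxCorr h hf hf hf hf, tendsto_boxForm h hf hf hf hf⟩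

theorem boxForm_eq_of_forall (h : CommPair μ T₁ T₂) {f₀ f₁ f₂ f₃ g₀ g₁ g₂ g₃ : X → ℝ}
    (h₀ : BddMeas f₀) (h₁ : BddMeas f₁) (h₂ : BddMeas f₂) (h₃ : BddMeas f₃)
    (k₀ : BddMeas g₀) (k₁ : BddMeas g₁) (k₂ : BddMeas g₂) (k₃ : BddMeas g₃)
    (heq : ∀ m n x, f₀ x * f₁ (T₁^[m] x) * f₂ (T₂^[n] x) * f₃ (T₁^[m] (T₂^[n] x)) =
      g₀ x * g₁ (T₁^[m] x) * g₂ (T₂^[n] x) * g₃ (T₁^[m] (T₂^[n] x))) :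
    boxForm μ T₁ T₂ f₀ f₁ f₂ f₃ = boxForm μ T₁ T₂ g₀ g₁ g₂ g₃ := by
  have : boxCorr μ T₁ T₂ f₀ f₁ f₂ f₃ = boxCorr μ T₁ T₂ g₀ g₁ g₂ g₃ := by
    funext n
    refine tendsto_nhds_unique (tendsto_boxCorr h h₀ h₁ h₂ h₃ n)
      ((tendsto_boxCorr h k₀ k₁ k₂ k₃ n).congr fun N => ?_)
    simp_rw [heq]
  refine tendsto_nhds_unique (tendsto_boxForm h h₀ h₁ h₂ h₃) ?_
  rw [this]
  exact tendsto_boxForm h k₀ k₁ k₂ k₃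

/-- Invariant factors may be moved between the entries of the box form. -/
theorem boxForm_mul_mul (h : CommPair μ T₁ T₂) {f a b f₁ f₂ f₃ : X → ℝ} (hf : BddMeas f)
    (ha : BddMeas a) (hb : BddMeas b) (h₁ : BddMeas f₁) (h₂ : BddMeas f₂) (h₃ : BddMeas f₃)
    (haT : ∀ x, a (T₁ x) = a x) (hbT : ∀ x, b (T₂ x) = b x) :
    boxForm μ T₁ T₂ (fun x => f x * (a x * b x)) f₁ f₂ f₃ =
      boxForm μ T₁ T₂ f (fun x => a x * f₁ x) (fun x => b x * f₂ x) f₃ := by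
  have e₁ : ∀ m x, a (T₁^[m] x) = a x := fun m x => by
    induction m with
    | zero => rfl
    | succ m ih => rw [Function.iterate_succ_apply', haT, ih]
  have e₂ : ∀ m x, b (T₂^[m] x) = b x := fun m x => by
    induction m with
    | zero => rfl
    | succ m ih => rw [Function.iterate_succ_apply', hbT, ih]
  refine boxForm_eq_of_forall h (hf.mul (ha.mul hb)) h₁ h₂ h₃ hf (ha.mul h₁) (hb.mul h₂) h₃
    fun m n x => ?_
  rw [e₁, e₂]
  ring

theorem boxForm_cauchySchwarz_left (h : CommPair μ T₁ T₂) {f g : X → ℝ} (hf : BddMeas f)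
    (hg : BddMeas g) (h0 : boxForm μ T₁ T₂ f f f f = 0) : boxForm μ T₁ T₂ f g f g = 0 := by
  have hle : ∀ t : ℝ, 2 * t * boxForm μ T₁ T₂ f g f g ≤ boxForm μ T₁ T₂ g g g g := by
    intro t
    have h1 : ∀ n, 2 * t * boxCorr μ T₁ T₂ f g f g n ≤
        t ^ 2 * boxCorr μ T₁ T₂ f f f f n + boxCorr μ T₁ T₂ g g g g n := by
      intro n
      have hn := h.right.measurable.iterate n
      have hA := hf.mul (hf.comp hn)
      have hB := hg.mul (hg.comp hn)
      simp only [boxCorr]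
      rw [integral_relSq_mul' hA hB, integral_relSq_mul' hA hA, integral_relSq_mul' hB hB,
        ← integral_const_mul, ← integral_const_mul, ← BddMeas.integral_add
        ((BddMeas.const _).mul (hA.invKernel.mul hA.invKernel)) (hB.invKernel.mul hB.invKernel)]
      refine integral_mono ((BddMeas.const _).mul (hA.invKernel.mul hB.invKernel)).integrable
        (((BddMeas.const _).mul (hA.invKernel.mul hA.invKernel)).add
        (hB.invKernel.mul hB.invKernel)).integrable fun x => ?_
      dsimp only
      nlinarith [sq_nonneg (t * (∫ y, f y * f (T₂^[n] y) ∂invKernel μ T₁ T₁ x) -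
        ∫ y, g y * g (T₂^[n] y) ∂invKernel μ T₁ T₁ x)]
    have h2 := (tendsto_boxForm h hf hg hf hg).const_mul (2 * t)
    have h3 := ((tendsto_boxForm h hf hf hf hf).const_mul (t ^ 2)).add
      (tendsto_boxForm h hg hg hg hg)
    rw [h0, mul_zero, zero_add] at h3
    refine le_of_tendsto_of_tendsto' h2 h3 fun N => ?_
    rw [← mul_div_assoc, ← mul_div_assoc, ← add_div, Finset.mul_sum, Finset.mul_sum,
      ← Finset.sum_add_distrib]
    exact div_le_div_of_nonneg_right (Finset.sum_le_sum fun n _ => h1 n) (Nat.cast_nonneg N)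
  by_contra hne
  have := hle ((boxForm μ T₁ T₂ g g g g + 1) / (2 * boxForm μ T₁ T₂ f g f g))
  field_simp at this
  linarith

/-- A function whose box average vanishes is orthogonal to all functions with respect to the
box form. -/
theorem boxForm_eq_zero (h : CommPair μ T₁ T₂) {f f₁ f₂ f₃ : X → ℝ} (hf : BddMeas f)
    (h₁ : BddMeas f₁) (h₂ : BddMeas f₂) (h₃ : BddMeas f₃) (h0 : boxForm μ T₁ T₂ f f f f = 0) :
    boxForm μ T₁ T₂ f f₁ f₂ f₃ = 0 := by
  have key := sq_integral_relSq_mul_le (μ := relSq μ T₁) (T := Prod.map T₂ T₂)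
    ((hf.comp (measurable_fst (β := X))).mul (h₁.comp measurable_snd))
    ((h₂.comp (measurable_fst (β := X))).mul (h₃.comp measurable_snd))
  have e := boxForm_cauchySchwarz_left h hf h₁ h0
  simp only [boxForm, boxMeas] at e ⊢
  rw [e, zero_mul] at key
  exact pow_eq_zero_iff two_ne_zero |>.1 (le_antisymm key (sq_nonneg _))

/-- The dual function represents the box form as an integral against its first entry. -/
theorem exists_dual_boxForm (μ : Measure X) [IsProbabilityMeasure μ] (T₁ T₂ : X → X)
    {f₁ f₂ f₃ : X → ℝ} (h₁ : BddMeas f₁) (h₂ : BddMeas f₂)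
    (h₃ : BddMeas f₃) : ∃ q : X → ℝ, BddMeas q ∧ ∀ f, BddMeas f →
      boxForm μ T₁ T₂ f f₁ f₂ f₃ = ∫ x, f x * q x ∂μ := by
  have hw := (h₂.comp (measurable_fst (β := X))).mul (h₃.comp measurable_snd)
  have hq := (h₁.comp (measurable_snd (α := X))).mul
    (hw.invKernel (μ := relSq μ T₁) (T₁ := Prod.map T₂ T₂) (T₂ := Prod.map T₂ T₂))
  refine ⟨_, hq.integral_kernel (κ := invKernel μ T₁ T₁), fun f hf => ?_⟩
  simp only [boxForm, boxMeas]
  rw [integral_relSq_mul (f := fun p : X × X => f p.1 * f₁ p.2) (g := fun p => f₂ p.1 * f₃ p.2)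
    ((hf.comp (measurable_fst (β := X))).mul (h₁.comp measurable_snd)) hw]
  simp_rw [mul_assoc]
  rw [integral_relSq ((hf.comp (measurable_fst (β := X))).mul hq)]
  simp_rw [integral_const_mul]

end BoxForm

section Decomposition

open ProbabilityTheory

theorem BddMeas.ae_eq_zero_of_integral_mul_self {X : Type*} [MeasurableSpace X] {μ : Measure X}
    [IsFiniteMeasure μ] {f : X → ℝ} (hf : BddMeas f) (h : ∫ x, f x * f x ∂μ = 0) :
    ∀ᵐ x ∂μ, f x = 0 := by
  have := (integral_eq_zero_iff_of_nonneg (fun x => mul_self_nonneg (f x))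
    (hf.mul hf).integrable).1 h
  filter_upwards [this] with x hx
  exact mul_self_eq_zero.1 hx

section ConditionalMean

variable {Ω X Z : Type*} [MeasurableSpace Ω] [MeasurableSpace X] [MeasurableSpace Z]
  {m : Measure Ω} [IsFiniteMeasure m] {a : Ω → X} {ρ : Ω → Z}

/-- The conditional expectation of `f ∘ a` given `ρ`, as a bounded measurable function of `ρ`. -/
theorem exists_conditional_mean [StandardBorelSpace X] [Nonempty X] (ha : Measurable a)
    (hρ : Measurable ρ) {f : X → ℝ} (hf : BddMeas f) : ∃ G : Z → ℝ, BddMeas G ∧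
      ∀ w, BddMeas w → ∫ ω, f (a ω) * w (ρ ω) ∂m = ∫ ω, G (ρ ω) * w (ρ ω) ∂m := by
  have hf' : BddMeas fun p : Z × X => f p.2 := hf.comp measurable_snd
  have hG := hf'.integral_kernel (κ := condDistrib a ρ m)
  refine ⟨_, hG, fun w hw => ?_⟩
  have hw' : BddMeas fun p : Z × X => w p.1 := hw.comp measurable_fst
  have e : ∫ p, f p.2 * w p.1 ∂(m.map fun ω => (ρ ω, a ω)) = ∫ ω, f (a ω) * w (ρ ω) ∂m :=
    integral_map (hρ.prodMk ha).aemeasurable (hf'.mul hw').1.aestronglyMeasurable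
  have e' : ∫ z, (∫ x, f x ∂condDistrib a ρ m z) * w z ∂(m.map ρ) =
      ∫ ω, (∫ x, f x ∂condDistrib a ρ m (ρ ω)) * w (ρ ω) ∂m :=
    integral_map hρ.aemeasurable (hG.mul hw).1.aestronglyMeasurable
  rw [← e, ← e', ← compProd_map_condDistrib ha.aemeasurable,
    Measure.integral_compProd (hf'.mul hw').integrable]
  simp_rw [integral_mul_const]

theorem conditional_mean_comp_ae {f : X → ℝ} (hf : BddMeas f) (ha : Measurable a)
    (hρ : Measurable ρ) {G : Z → ℝ} (hG : BddMeas G)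
    (hGf : ∀ w, BddMeas w → ∫ ω, f (a ω) * w (ρ ω) ∂m = ∫ ω, G (ρ ω) * w (ρ ω) ∂m)
    {R : Ω → Ω} (hR : MeasurePreserving R m m) {R' : Z → Z} (hR' : Measurable R')
    (hρR : ∀ ω, ρ (R ω) = R' (ρ ω)) (haR : ∀ ω, a (R ω) = a ω) :
    ∀ᵐ ω ∂m, G (ρ (R ω)) = G (ρ ω) := by
  have hGρ := hG.comp hρ
  have hGR := hGρ.comp hR.measurable
  have e₁ : ∫ ω, G (ρ (R ω)) * G (ρ (R ω)) ∂m = ∫ ω, G (ρ ω) * G (ρ ω) ∂m :=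
    (hGρ.mul hGρ).integral_comp hR
  have e₂ : ∫ ω, G (ρ ω) * G (ρ (R ω)) ∂m = ∫ ω, G (ρ ω) * G (ρ ω) ∂m := by
    simp_rw [hρR]
    rw [← hGf _ (hG.comp hR'), ← hGf _ hG, ← ((hf.comp ha).mul hGρ).integral_comp hR]
    simp_rw [haR, hρR]
  have h0 : ∫ ω, (G (ρ (R ω)) - G (ρ ω)) * (G (ρ (R ω)) - G (ρ ω)) ∂m = 0 := by
    have : ∀ ω, (G (ρ (R ω)) - G (ρ ω)) * (G (ρ (R ω)) - G (ρ ω)) =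
        G (ρ (R ω)) * G (ρ (R ω)) - 2 * (G (ρ ω) * G (ρ (R ω))) + G (ρ ω) * G (ρ ω) :=
      fun ω => by ring
    simp_rw [this]
    rw [((hGR.mul hGR).sub ((BddMeas.const _).mul (hGρ.mul hGR))).integral_add (hGρ.mul hGρ),
      (hGR.mul hGR).integral_sub ((BddMeas.const _).mul (hGρ.mul hGR)), integral_const_mul,
      e₁, e₂]
    ring
  filter_upwards [(hGR.sub hGρ).ae_eq_zero_of_integral_mul_self h0] with ω hω
  linarith

end ConditionalMean

variable {X : Type*} [mX : MeasurableSpace X] [StandardBorelSpace X]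
  {μ : Measure X} [IsProbabilityMeasure μ] {T₁ T₂ : X → X}

theorem CommPair.measurePreserving_fst_boxMeas :
    MeasurePreserving (fun p : (X × X) × (X × X) => p.1.1) (boxMeas μ T₁ T₂) μ :=
  measurePreserving_fst_relSq.comp measurePreserving_fst_relSq

/-- Every function is the sum of a function which is a function of the last three coordinates of
the box measure, and of a function whose box average vanishes. -/
theorem exists_boxForm_decomposition (h : CommPair μ T₁ T₂) {f : X → ℝ} (hf : BddMeas f) :
    ∃ (g : X → ℝ) (G : X × (X × X) → ℝ), BddMeas g ∧ BddMeas G ∧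
      (∀ᵐ p ∂boxMeas μ T₁ T₂, g p.1.1 = G (p.1.2, p.2)) ∧
      boxForm μ T₁ T₂ (fun x => f x - g x) (fun x => f x - g x) (fun x => f x - g x)
        (fun x => f x - g x) = 0 := by
  have : Nonempty X := nonempty_of_isProbabilityMeasure μ
  have ha : Measurable fun p : (X × X) × (X × X) => p.1.1 := measurable_fst.fst
  have hρ : Measurable fun p : (X × X) × (X × X) => (p.1.2, p.2) :=
    measurable_fst.snd.prodMk measurable_snd
  obtain ⟨G, hG, hGf⟩ := exists_conditional_mean (m := boxMeas μ T₁ T₂) ha hρ hf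
  set Φ : (X × X) × (X × X) → ℝ := fun p => G (p.1.2, p.2) with hΦ
  have hΦb : BddMeas Φ := hG.comp hρ
  have hTT := h.prodMap
  have hIT : MeasurePreserving (Prod.map id T₁) (relSq μ T₁) (relSq μ T₁) :=
    measurePreserving_id_prodMap_relSq h.left
  have hR₂ : MeasurePreserving (Prod.map id (Prod.map T₂ T₂)) (boxMeas μ T₁ T₂)
    (boxMeas μ T₁ T₂) := measurePreserving_id_prodMap_relSq hTT
  have hR₁ : MeasurePreserving (Prod.map (Prod.map id T₁) (Prod.map id T₁)) (boxMeas μ T₁ T₂)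
    (boxMeas μ T₁ T₂) := measurePreserving_prodMap_relSq hTT hIT fun p =>
      Prod.ext rfl (h.comm p.2)
  have i₂ : ∀ᵐ p ∂boxMeas μ T₁ T₂, Φ (p.1, Prod.map T₂ T₂ p.2) = Φ p :=
    conditional_mean_comp_ae hf ha hρ hG hGf hR₂ (R' := Prod.map id (Prod.map T₂ T₂))
      (measurable_id.prodMap hTT.measurable) (fun _ => rfl) fun _ => rfl
  have i₁ : ∀ᵐ p ∂boxMeas μ T₁ T₂, Φ (Prod.map (Prod.map id T₁) (Prod.map id T₁) p) = Φ p :=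
    conditional_mean_comp_ae hf ha hρ hG hGf hR₁ (R' := Prod.map T₁ (Prod.map id T₁))
      (h.left.measurable.prodMap hIT.measurable) (fun _ => rfl) fun _ => rfl
  have j₂ := ae_eq_integral_invKernel_of_comp_ae_eq hTT hΦb i₂
  set φ : X × X → ℝ := fun x => ∫ y, Φ (x, y) ∂invKernel (relSq μ T₁) (Prod.map T₂ T₂)
    (Prod.map T₂ T₂) x with hφ
  have hφb : BddMeas φ := hΦb.integral_kernel
  have hfst : MeasurePreserving Prod.fst (boxMeas μ T₁ T₂) (relSq μ T₁) :=
    measurePreserving_fst_relSq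
  have i₃ : ∀ᵐ x ∂relSq μ T₁, φ (x.1, T₁ x.2) = φ x := by
    have hmeas : MeasurableSet {x : X × X | φ (x.1, T₁ x.2) = φ x} :=
      measurableSet_eq_fun (hφb.1.comp (measurable_fst.prodMk
        (h.left.measurable.comp measurable_snd))) hφb.1
    rw [← hfst.map_eq, ae_map_iff hfst.aemeasurable hmeas]
    filter_upwards [j₂, i₁, hR₁.quasiMeasurePreserving.ae j₂] with p h1 h2 h3
    exact h3.symm.trans (h2.trans h1)
  have j₁ := ae_eq_integral_invKernel_of_comp_ae_eq h.left hφb i₃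
  have hgb : BddMeas fun x => ∫ y, φ (x, y) ∂invKernel μ T₁ T₁ x := hφb.integral_kernel
  set g : X → ℝ := fun x => ∫ y, φ (x, y) ∂invKernel μ T₁ T₁ x with hg
  have hgG : ∀ᵐ p ∂boxMeas μ T₁ T₂, g p.1.1 = G (p.1.2, p.2) := by
    filter_upwards [j₂, hfst.quasiMeasurePreserving.ae j₁] with p h1 h2
    exact (h1.trans h2).symm
  refine ⟨g, G, hgb, hG, hgG, ?_⟩
  have hfg := hf.sub hgb
  set w : X × (X × X) → ℝ := fun z => (f z.1 - g z.1) *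
    ((f z.2.1 - g z.2.1) * (f z.2.2 - g z.2.2)) with hw
  have hwb : BddMeas w := (hfg.comp measurable_fst).mul
    ((hfg.comp measurable_snd.fst).mul (hfg.comp measurable_snd.snd))
  have e := hGf w hwb
  have e1 : ∀ p : (X × X) × (X × X), (f p.1.1 - g p.1.1) * (f p.1.2 - g p.1.2) *
      ((f p.2.1 - g p.2.1) * (f p.2.2 - g p.2.2)) =
      f p.1.1 * w (p.1.2, p.2) - g p.1.1 * w (p.1.2, p.2) := fun p => by
    simp only [hw]; ring
  simp only [boxForm, e1]
  rw [((hf.comp ha).mul (hwb.comp hρ)).integral_sub ((hgb.comp ha).mul (hwb.comp hρ)), e,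
    sub_eq_zero]
  refine integral_congr_ae ?_
  filter_upwards [hgG] with p hp
  rw [hp]

end Decomposition

section MagicCriterion

open ProbabilityTheory

theorem invSigma_le {X : Type*} [mX : MeasurableSpace X] (T : X → X) : invSigma T ≤ mX :=
  fun _ h => h.1

theorem setIntegral_eq_zero_of_isPiSystem {X : Type*} {m mX : MeasurableSpace X} {μ : Measure X}
    (hm : m ≤ mX) {f : X → ℝ} (hf : Integrable f μ) {𝒟 : Set (Set X)}
    (hgen : m = MeasurableSpace.generateFrom 𝒟) (hpi : IsPiSystem 𝒟) (huniv : ∫ x, f x ∂μ = 0)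
    (h : ∀ D ∈ 𝒟, ∫ x in D, f x ∂μ = 0) {D : Set X} (hD : MeasurableSet[m] D) :
    ∫ x in D, f x ∂μ = 0 := by
  induction D, hD using MeasurableSpace.induction_on_inter hgen hpi with
  | empty => simp
  | basic D hD => exact h D hD
  | compl D hD ih =>
    have := integral_add_compl (hm _ hD) hf
    rw [ih, zero_add, huniv] at this
    exact this
  | iUnion F hdisj hF ih =>
    rw [integral_iUnion (fun i => hm _ (hF i)) hdisj hf.integrableOn]
    simp [ih]

theorem integral_condExp_mul {X : Type*} {m mX : MeasurableSpace X} {μ : Measure X}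
    [IsFiniteMeasure μ] (hm : m ≤ mX) {f w : X → ℝ} (hf : BddMeas f) (hw : BddMeas w)
    (hwm : Measurable[m] w) : ∫ x, (μ[f|m]) x * w x ∂μ = ∫ x, f x * w x ∂μ := by
  rw [← integral_condExp hm (f := fun x => f x * w x)]
  exact integral_congr_ae (condExp_mul_of_stronglyMeasurable_right (f := f) (g := w) (μ := μ)
    hwm.stronglyMeasurable (hf.mul hw).integrable hf.integrable).symm

theorem BddMeas.exists_condExp_ae_eq {X : Type*} {m : MeasurableSpace X} [mX : MeasurableSpace X]
    [StandardBorelSpace X] {μ : Measure X} [IsProbabilityMeasure μ] (hm : m ≤ mX) {f : X → ℝ}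
    (hf : BddMeas f) : ∃ e : X → ℝ, BddMeas e ∧ Measurable[m] e ∧ μ[f|m] =ᵐ[μ] e := by
  have : Nonempty X := nonempty_of_isProbabilityMeasure μ
  refine ⟨fun x => ∫ y, f y ∂condExpKernel μ m x, ⟨?_, ?_⟩, ?_, ?_⟩
  · exact (hf.1.stronglyMeasurable.integral_condExpKernel.measurable).mono hm le_rfl
  · obtain ⟨hf, C, hC⟩ := hf
    refine ⟨C, fun x => ?_⟩
    have := norm_integral_le_of_norm_le_const (μ := condExpKernel μ m x) (f := f) (C := C)
      (ae_of_all _ hC)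
    simpa using this
  · exact hf.1.stronglyMeasurable.integral_condExpKernel.measurable
  · exact condExp_ae_eq_integral_condExpKernel hm hf.integrable

theorem indicator_comp_of_preimage_eq {X : Type*} {T : X → X} {s : Set X} (h : T ⁻¹' s = s)
    (x : X) : s.indicator (fun _ => (1 : ℝ)) (T x) = s.indicator (fun _ => (1 : ℝ)) x := by
  have : T x ∈ s ↔ x ∈ s := by rw [← Set.mem_preimage, h]
  by_cases hx : x ∈ s <;> simp [this, hx]

theorem setIntegral_inter_eq_integral_mul {X : Type*} [MeasurableSpace X] {μ : Measure X}
    {a b : Set X} (ha : MeasurableSet a) (hb : MeasurableSet b) (f : X → ℝ) :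
    ∫ x in a ∩ b, f x ∂μ =
      ∫ x, f x * (a.indicator (fun _ => (1 : ℝ)) x * b.indicator (fun _ => (1 : ℝ)) x) ∂μ := by
  rw [← integral_mul_indicator_one (ha.inter hb)]
  congr 1
  funext x
  by_cases hx : x ∈ a <;> by_cases hy : x ∈ b <;> simp [hx, hy]

theorem invSigma_sup_eq_generateFrom {X : Type*} [MeasurableSpace X] (T₁ T₂ : X → X) :
    invSigma T₁ ⊔ invSigma T₂ = MeasurableSpace.generateFrom
      {D | ∃ a b, MeasurableSet[invSigma T₁] a ∧ MeasurableSet[invSigma T₂] b ∧ D = a ∩ b} := by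
  refine le_antisymm (sup_le ?_ ?_) (MeasurableSpace.generateFrom_le ?_)
  · exact fun a ha => MeasurableSpace.measurableSet_generateFrom
      ⟨a, Set.univ, ha, MeasurableSet.univ, by simp⟩
  · exact fun b hb => MeasurableSpace.measurableSet_generateFrom
      ⟨Set.univ, b, MeasurableSet.univ, hb, by simp⟩
  · rintro _ ⟨a, b, ha, hb, rfl⟩
    have ha' : MeasurableSet[invSigma T₁ ⊔ invSigma T₂] a :=
      (le_sup_left : invSigma T₁ ≤ invSigma T₁ ⊔ invSigma T₂) a ha
    have hb' : MeasurableSet[invSigma T₁ ⊔ invSigma T₂] b :=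
      (le_sup_right : invSigma T₂ ≤ invSigma T₁ ⊔ invSigma T₂) b hb
    exact ha'.inter hb'

variable {Y : Type*} [mY : MeasurableSpace Y] [StandardBorelSpace Y]
  {ν : Measure Y} [IsProbabilityMeasure ν]

theorem boxForm_mul_indicator {S₁ S₂ : Y → Y} (h : CommPair ν S₁ S₂) {u f₁ f₂ f₃ : Y → ℝ}
    (hu : BddMeas u) (h₁ : BddMeas f₁) (h₂ : BddMeas f₂) (h₃ : BddMeas f₃)
    (hu0 : boxForm ν S₁ S₂ u u u u = 0) {a b : Set Y} (ha : MeasurableSet[invSigma S₁] a)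
    (hb : MeasurableSet[invSigma S₂] b) :
    boxForm ν S₁ S₂ (fun y => u y *
      (a.indicator (fun _ => (1 : ℝ)) y * b.indicator (fun _ => (1 : ℝ)) y)) f₁ f₂ f₃ = 0 := by
  have ha' : BddMeas (a.indicator fun _ => (1 : ℝ)) := .indicator_one ha.1
  have hb' : BddMeas (b.indicator fun _ => (1 : ℝ)) := .indicator_one hb.1
  rw [boxForm_mul_mul h hu ha' hb' h₁ h₂ h₃ (indicator_comp_of_preimage_eq ha.2)
    (indicator_comp_of_preimage_eq hb.2)]
  exact boxForm_eq_zero h hu (ha'.mul h₁) (hb'.mul h₂) h₃ hu0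

theorem condExp_eq_zero_of_boxForm {S₁ S₂ : Y → Y} (h : CommPair ν S₁ S₂) {u : Y → ℝ}
    (hu : BddMeas u) (hu0 : boxForm ν S₁ S₂ u u u u = 0) :
    ν[u|invSigma S₁ ⊔ invSigma S₂] =ᵐ[ν] 0 := by
  have hm : invSigma S₁ ⊔ invSigma S₂ ≤ mY := sup_le (invSigma_le _) (invSigma_le _)
  have hab : ∀ a b, MeasurableSet[invSigma S₁] a → MeasurableSet[invSigma S₂] b →
      ∫ y in a ∩ b, u y ∂ν = 0 := by
    intro a b ha hb
    have h1 : BddMeas fun _ : Y => (1 : ℝ) := .const 1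
    obtain ⟨q, -, hq⟩ := exists_dual_boxForm ν S₁ S₂ h1 h1 h1
    rw [setIntegral_inter_eq_integral_mul ha.1 hb.1,
      ← boxForm_mul_indicator h hu h1 h1 h1 hu0 ha hb]
    have hub := hu.mul ((BddMeas.indicator_one ha.1).mul (.indicator_one hb.1))
    simp only [boxForm, mul_one]
    exact (hub.integral_comp CommPair.measurePreserving_fst_boxMeas).symm
  refine (ae_eq_condExp_of_forall_setIntegral_eq hm hu.integrable
    (fun _ _ _ => integrableOn_zero) (fun D hD _ => ?_)
    stronglyMeasurable_zero.aestronglyMeasurable).symm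
  rw [setIntegral_eq_zero_of_isPiSystem hm hu.integrable (invSigma_sup_eq_generateFrom S₁ S₂)
    ?_ ?_ ?_ hD]
  · simp
  · rintro _ ⟨a, b, ha, hb, rfl⟩ _ ⟨a', b', ha', hb', rfl⟩ -
    exact ⟨a ∩ a', b ∩ b', ha.inter ha', hb.inter hb', Set.inter_inter_inter_comm _ _ _ _⟩
  · simpa using hab Set.univ Set.univ MeasurableSet.univ MeasurableSet.univ
  · rintro _ ⟨a, b, ha, hb, rfl⟩
    exact hab a b ha hb

/-- A system is magic as soon as, for sufficiently many sets, the indicator function is the sum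
of a function with vanishing box average and a function of the invariant sets. -/
theorem isMagic_of_decomposition {S₁ S₂ : Y ≃ᵐ Y} (h : CommPair ν S₁ S₂) {𝒞 : Set (Set Y)}
    (huniv : Set.univ ∈ 𝒞) (hpi : IsPiSystem 𝒞)
    (hgen : mY = MeasurableSpace.generateFrom 𝒞 ⊔ (invSigma ⇑S₁ ⊔ invSigma ⇑S₂))
    (hdec : ∀ C ∈ 𝒞, ∃ u v v' : Y → ℝ, BddMeas u ∧ BddMeas v' ∧
      Measurable[invSigma ⇑S₁ ⊔ invSigma ⇑S₂] v' ∧ v =ᵐ[ν] v' ∧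
      boxForm ν S₁ S₂ u u u u = 0 ∧
      ∀ y, C.indicator (fun _ => (1 : ℝ)) y = u y + v y) :
    IsMagic ν S₁ S₂ := by
  intro F hFm hFb hF0
  have hF : BddMeas F := ⟨hFm, hFb⟩
  have hm : invSigma ⇑S₁ ⊔ invSigma ⇑S₂ ≤ mY := sup_le (invSigma_le _) (invSigma_le _)
  obtain ⟨q, hq, hqF⟩ := exists_dual_boxForm ν S₁ S₂ hF hF hF
  obtain ⟨e, he, hem, heq⟩ := hq.exists_condExp_ae_eq (μ := ν) hm
  have hCm : ∀ C ∈ 𝒞, MeasurableSet C := fun C hC => by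
    rw [hgen]
    exact (le_sup_left : MeasurableSpace.generateFrom 𝒞 ≤ _) _
      (MeasurableSpace.measurableSet_generateFrom hC)
  have hr : BddMeas fun y => q y - e y := hq.sub he
  have hrW : ∀ w, BddMeas w → Measurable[invSigma ⇑S₁ ⊔ invSigma ⇑S₂] w →
      ∫ y, (q y - e y) * w y ∂ν = 0 := by
    intro w hw hwm
    simp_rw [sub_mul]
    rw [(hq.mul hw).integral_sub (he.mul hw), ← integral_condExp_mul hm hq hw hwm, sub_eq_zero]
    refine integral_congr_ae ?_
    filter_upwards [heq] with y hy
    rw [hy]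
  have hD : ∀ C ∈ 𝒞, ∀ a b, MeasurableSet[invSigma ⇑S₁] a → MeasurableSet[invSigma ⇑S₂] b →
      ∫ y in C ∩ (a ∩ b), (q y - e y) ∂ν = 0 := by
    intro C hC a b ha hb
    obtain ⟨u, v, v', hu, hv', hv'm, hvv', hu0, huv⟩ := hdec C hC
    have hia : BddMeas (a.indicator fun _ => (1 : ℝ)) := .indicator_one ha.1
    have hib : BddMeas (b.indicator fun _ => (1 : ℝ)) := .indicator_one hb.1
    set w : Y → ℝ := fun y => a.indicator (fun _ => (1 : ℝ)) y * b.indicator (fun _ => 1) y with hw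
    have hwb : BddMeas w := hia.mul hib
    have hwm : Measurable[invSigma ⇑S₁ ⊔ invSigma ⇑S₂] w := by
      refine Measurable.mul ?_ ?_
      · exact measurable_const.indicator
          ((le_sup_left : invSigma ⇑S₁ ≤ invSigma ⇑S₁ ⊔ invSigma ⇑S₂) a ha)
      · exact measurable_const.indicator
          ((le_sup_right : invSigma ⇑S₂ ≤ invSigma ⇑S₁ ⊔ invSigma ⇑S₂) b hb)
    have e1 : ∫ y in C ∩ (a ∩ b), (q y - e y) ∂ν =
        ∫ y, (u y * w y * q y - u y * (w y * e y) + (q y - e y) * (v' y * w y)) ∂ν := by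
      rw [setIntegral_inter_eq_integral_mul (hCm C hC) (ha.1.inter hb.1)]
      refine integral_congr_ae ?_
      filter_upwards [hvv'] with y hy
      have : (a ∩ b).indicator (fun _ => (1 : ℝ)) y = w y := by
        simp only [hw]
        by_cases hya : y ∈ a <;> by_cases hyb : y ∈ b <;> simp [hya, hyb]
      rw [huv, this, hy]
      ring
    have e2 : ∫ y, u y * w y * q y ∂ν = 0 := by
      rw [← hqF _ (hu.mul hwb)]
      exact boxForm_mul_indicator h hu hF hF hF hu0 ha hb
    have e3 : ∫ y, u y * (w y * e y) ∂ν = 0 := by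
      rw [← integral_condExp_mul hm hu (hwb.mul he) (hwm.mul hem)]
      rw [integral_congr_ae (g := fun _ => (0 : ℝ)), integral_zero]
      filter_upwards [condExp_eq_zero_of_boxForm h hu hu0] with y hy
      rw [hy, Pi.zero_apply, zero_mul]
    rw [e1, (((hu.mul hwb).mul hq).sub (hu.mul (hwb.mul he))).integral_add
      (hr.mul (hv'.mul hwb)), ((hu.mul hwb).mul hq).integral_sub (hu.mul (hwb.mul he)), e2, e3,
      hrW _ (hv'.mul hwb) (hv'm.mul hwm)]
    ring
  have hqe : (fun y => q y - e y) =ᵐ[ν] 0 := by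
    refine hr.integrable.ae_eq_zero_of_forall_setIntegral_eq_zero fun D hDm _ => ?_
    refine setIntegral_eq_zero_of_isPiSystem le_rfl hr.integrable
      (𝒟 := {D | ∃ C ∈ 𝒞, ∃ a b, MeasurableSet[invSigma ⇑S₁] a ∧
        MeasurableSet[invSigma ⇑S₂] b ∧ D = C ∩ (a ∩ b)}) ?_ ?_ ?_ ?_ hDm
    · refine le_antisymm ?_ (MeasurableSpace.generateFrom_le ?_)
      · conv_lhs => rw [hgen, invSigma_sup_eq_generateFrom]
        refine sup_le (MeasurableSpace.generateFrom_le ?_) (MeasurableSpace.generateFrom_le ?_)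
        · exact fun C hC => MeasurableSpace.measurableSet_generateFrom
            ⟨C, hC, Set.univ, Set.univ, MeasurableSet.univ, MeasurableSet.univ, by simp⟩
        · rintro _ ⟨a, b, ha, hb, rfl⟩
          exact MeasurableSpace.measurableSet_generateFrom ⟨Set.univ, huniv, a, b, ha, hb, by simp⟩
      · rintro _ ⟨C, hC, a, b, ha, hb, rfl⟩
        exact (hCm C hC).inter (ha.1.inter hb.1)
    · rintro _ ⟨C, hC, a, b, ha, hb, rfl⟩ _ ⟨C', hC', a', b', ha', hb', rfl⟩ hne
      refine ⟨C ∩ C', hpi C hC C' hC' (hne.mono fun y hy => ⟨hy.1.1, hy.2.1⟩), a ∩ a', b ∩ b',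
        ha.inter ha', hb.inter hb', ?_⟩
      rw [Set.inter_inter_inter_comm, Set.inter_inter_inter_comm a]
    · simpa using hrW (fun _ => 1) (.const 1) measurable_const
    · rintro _ ⟨C, hC, a, b, ha, hb, rfl⟩
      exact hD C hC a b ha hb
  have hbox : boxForm ν S₁ S₂ F F F F = 0 := by
    rw [hqF F hF]
    have e1 : ∫ y, F y * q y ∂ν = ∫ y, F y * e y ∂ν := by
      refine integral_congr_ae ?_
      filter_upwards [hqe] with y hy
      rw [sub_eq_zero.1 hy]
    rw [e1, ← integral_condExp_mul hm hF he hem, integral_congr_ae (g := fun _ => (0 : ℝ)),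
      integral_zero]
    filter_upwards [hF0] with y hy
    rw [hy, Pi.zero_apply, zero_mul]
  rw [← hbox]
  exact hasBoxAvg_boxForm h hF

end MagicCriterion

section InvariantSets

variable {X : Type*} [mX : MeasurableSpace X]

/-- The set of points which visit `s` infinitely often under iteration of `T`. -/
def recurrentSet (T : X → X) (s : Set X) : Set X := {x | ∃ᶠ n in atTop, T^[n] x ∈ s}

omit mX in
theorem preimage_recurrentSet (T : X → X) (s : Set X) :
    T ⁻¹' recurrentSet T s = recurrentSet T s := by
  ext x
  change (∃ᶠ n in atTop, T^[n + 1] x ∈ s) ↔ ∃ᶠ n in atTop, T^[n] x ∈ s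
  conv_rhs => rw [← map_add_atTop_eq_nat 1, frequently_map]

theorem measurableSet_recurrentSet {T : X → X} (hT : Measurable T) {s : Set X}
    (hs : MeasurableSet s) : MeasurableSet (recurrentSet T s) := by
  have : recurrentSet T s = limsup (fun n => T^[n] ⁻¹' s) atTop := by
    ext x
    rw [mem_limsup_iff_frequently_mem]
    rfl
  rw [this]
  exact .measurableSet_limsup fun n => hT.iterate n hs

theorem recurrentSet_ae_eq {μ : Measure X} {T : X → X} (hT : MeasurePreserving T μ μ) {s : Set X}
    (hTs : T ⁻¹' s =ᵐ[μ] s) : recurrentSet T s =ᵐ[μ] s := by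
  have h : ∀ᵐ x ∂μ, ∀ n, (T^[n] x ∈ s ↔ x ∈ s) := by
    refine ae_all_iff.2 fun n => ?_
    induction n with
    | zero => exact ae_of_all _ fun x => Iff.rfl
    | succ n ih =>
      filter_upwards [hT.quasiMeasurePreserving.ae ih, hTs.mem_iff] with x h1 h2
      rw [Function.iterate_succ_apply]
      exact h1.trans h2
  refine eventuallyEq_set.2 ?_
  filter_upwards [h] with x hx
  simp [recurrentSet, hx]

/-- Ergodicity can be tested on sets which are only invariant up to null sets. -/
theorem CommPair.measure_eq_zero_or_one {μ : Measure X} {T₁ T₂ : X → X} (h : CommPair μ T₁ T₂)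
    (herg : ∀ s, MeasurableSet s → T₁ ⁻¹' s = s → T₂ ⁻¹' s = s → μ s = 0 ∨ μ s = 1)
    {s : Set X} (hs : MeasurableSet[aeInv μ T₁ T₂] s) : μ s = 0 ∨ μ s = 1 := by
  obtain ⟨hs, hs₁, hs₂⟩ := hs
  set u := recurrentSet T₁ s with hu
  have hum : MeasurableSet u := measurableSet_recurrentSet h.left.measurable hs
  have hus : u =ᵐ[μ] s := recurrentSet_ae_eq h.left hs₁
  have hu₂ : T₂ ⁻¹' u =ᵐ[μ] u :=
    (h.right.quasiMeasurePreserving.preimage_ae_eq hus).trans (hs₂.trans hus.symm)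
  set v := recurrentSet T₂ u with hv
  have hvu : v =ᵐ[μ] u := recurrentSet_ae_eq h.right hu₂
  have hv₁ : T₁ ⁻¹' v = v := by
    ext x
    have e : ∀ n, T₂^[n] (T₁ x) = T₁ (T₂^[n] x) := fun n =>
      ((Function.Semiconj.iterate_right (f := T₁) (ga := T₂) (gb := T₂) h.comm n) x).symm
    have e' : ∀ y, T₁ y ∈ u ↔ y ∈ u := fun y => by
      rw [← Set.mem_preimage, hu, preimage_recurrentSet]
    change (∃ᶠ n in atTop, T₂^[n] (T₁ x) ∈ u) ↔ ∃ᶠ n in atTop, T₂^[n] x ∈ u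
    simp only [e, e']
  rw [← measure_congr (hvu.trans hus)]
  exact herg v (measurableSet_recurrentSet h.right.measurable hum) hv₁ (preimage_recurrentSet _ _)

theorem condExp_aeInv_eq_const {μ : Measure X} [IsProbabilityMeasure μ] {T₁ T₂ : X → X}
    (herg : ∀ s, MeasurableSet[aeInv μ T₁ T₂] s → μ s = 0 ∨ μ s = 1) {f : X → ℝ}
    (hf : BddMeas f) : μ[f|aeInv μ T₁ T₂] =ᵐ[μ] fun _ => ∫ x, f x ∂μ := by
  refine (ae_eq_condExp_of_forall_setIntegral_eq (aeInv_le μ T₁ T₂) hf.integrable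
    (fun _ _ _ => (integrable_const _).integrableOn) (fun s hs _ => ?_)
    stronglyMeasurable_const.aestronglyMeasurable).symm
  rcases herg s hs with h0 | h1
  · rw [setIntegral_measure_zero _ h0, setIntegral_measure_zero _ h0]
  · have : s =ᵐ[μ] Set.univ :=
      (ae_eq_univ_iff_measure_eq hs.1.nullMeasurableSet).2 (by rw [h1, measure_univ])
    rw [setIntegral_congr_set this, setIntegral_congr_set this]
    simp

omit mX in
theorem ergAvg_comp {Y : Type*} {S₁ S₂ : Y → Y} {T₁ T₂ : X → X} {p : Y → X}
    (h₁ : ∀ y, p (S₁ y) = T₁ (p y)) (h₂ : ∀ y, p (S₂ y) = T₂ (p y)) (N : ℕ) (f : X → ℝ) :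
    ergAvg S₁ S₂ N (fun y => f (p y)) = fun y => ergAvg T₁ T₂ N f (p y) := by
  have : ∀ n, (avgOp S₁ S₂)^[n] (fun y => f (p y)) = fun y => (avgOp T₁ T₂)^[n] f (p y) := by
    intro n
    induction n with
    | zero => rfl
    | succ n ih =>
      rw [Function.iterate_succ_apply', Function.iterate_succ_apply', ih]
      funext y
      simp [avgOp, h₁, h₂]
  funext y
  simp [ergAvg, this]

/-- Functions lifted from an ergodic factor have constant conditional expectations on the
invariant sets. -/
theorem condExp_aeInv_comp_eq_const {Y : Type*} [MeasurableSpace Y] {ν : Measure Y}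
    [IsProbabilityMeasure ν] {μ : Measure X} [IsProbabilityMeasure μ] {S₁ S₂ : Y → Y}
    {T₁ T₂ : X → X} {p : Y → X} (hp : MeasurePreserving p ν μ) (hS : CommPair ν S₁ S₂)
    (hT : CommPair μ T₁ T₂) (h₁ : ∀ y, p (S₁ y) = T₁ (p y)) (h₂ : ∀ y, p (S₂ y) = T₂ (p y))
    (herg : ∀ s, MeasurableSet[aeInv μ T₁ T₂] s → μ s = 0 ∨ μ s = 1) {f : X → ℝ}
    (hf : BddMeas f) :
    ν[fun y => f (p y)|aeInv ν S₁ S₂] =ᵐ[ν] fun _ => ∫ x, f x ∂μ := by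
  set c := ∫ x, f x ∂μ
  set E := ν[fun y => f (p y)|aeInv ν S₁ S₂] with hE
  have hfp := hf.comp hp.measurable
  have l₁ : Tendsto (fun N => ∫ y, (ergAvg S₁ S₂ N (fun y => f (p y)) y - c) ^ 2 ∂ν) atTop
      (𝓝 0) := by
    refine (tendsto_ergAvg hT.left hT.right hf).congr fun N => ?_
    have hA := (hf.ergAvg hT.left.measurable hT.right.measurable N).sub (.const c)
    rw [ergAvg_comp h₁ h₂]
    simp only [pow_two]
    rw [(hA.mul hA).integral_comp hp]
    refine integral_congr_ae ?_
    filter_upwards [condExp_aeInv_eq_const herg hf] with x hx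
    rw [hx]
  have l₂ := tendsto_ergAvg hS.left hS.right hfp
  have hEm : MemLp (fun y => E y - c) 2 ν := ((hfp.memLp 2).condExp one_le_two).sub (memLp_const c)
  have hle : ∀ N, ∫ y, (E y - c) ^ 2 ∂ν ≤
      2 * ∫ y, (ergAvg S₁ S₂ N (fun y => f (p y)) y - E y) ^ 2 ∂ν +
      2 * ∫ y, (ergAvg S₁ S₂ N (fun y => f (p y)) y - c) ^ 2 ∂ν := by
    intro N
    have hA := hfp.ergAvg hS.left.measurable hS.right.measurable N
    have m₁ : MemLp (fun y => ergAvg S₁ S₂ N (fun y => f (p y)) y - E y) 2 ν :=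
      (hA.memLp 2).sub ((hfp.memLp 2).condExp one_le_two)
    have m₂ : MemLp (fun y => ergAvg S₁ S₂ N (fun y => f (p y)) y - c) 2 ν :=
      (hA.memLp 2).sub (memLp_const c)
    rw [← integral_const_mul, ← integral_const_mul, ← integral_add
      (m₁.integrable_sq.const_mul 2) (m₂.integrable_sq.const_mul 2)]
    refine integral_mono hEm.integrable_sq
      ((m₁.integrable_sq.const_mul 2).add (m₂.integrable_sq.const_mul 2)) fun y => ?_
    dsimp only [Pi.add_apply]
    nlinarith [sq_nonneg ((ergAvg S₁ S₂ N (fun y => f (p y)) y - E y) +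
      (ergAvg S₁ S₂ N (fun y => f (p y)) y - c))]
  have h0 : ∫ y, (E y - c) ^ 2 ∂ν = 0 := by
    refine le_antisymm ?_ (integral_nonneg fun y => sq_nonneg _)
    have l₃ := (l₂.const_mul 2).add (l₁.const_mul 2)
    rw [mul_zero, add_zero] at l₃
    exact ge_of_tendsto' l₃ hle
  rw [integral_eq_zero_iff_of_nonneg (fun y => sq_nonneg _) hEm.integrable_sq] at h0
  filter_upwards [h0] with y hy
  exact sub_eq_zero.1 (pow_eq_zero_iff two_ne_zero |>.1 hy)

theorem ae_ae_invKernel [StandardBorelSpace X] {μ : Measure X} [IsProbabilityMeasure μ]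
    {T₁ T₂ : X → X} {P : X → Prop} (h : ∀ᵐ x ∂μ, P x) :
    ∀ᵐ x ∂μ, ∀ᵐ y ∂invKernel μ T₁ T₂ x, P y := by
  obtain ⟨s, hs, hsm, hs0⟩ := exists_measurable_superset_of_null h
  have hf : BddMeas (s.indicator fun _ => (1 : ℝ)) := .indicator_one hsm
  have h1 := integral_integral_invKernel (μ := μ) (T₁ := T₁) (T₂ := T₂) hf
  have h2 : ∫ x, s.indicator (fun _ => (1 : ℝ)) x ∂μ = 0 := by
    rw [integral_indicator hsm]; simp [Measure.real, hs0]
  rw [h2, integral_eq_zero_iff_of_nonneg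
    (fun x => integral_nonneg fun y => Set.indicator_nonneg (fun _ _ => zero_le_one) _)
    hf.invKernel.integrable] at h1
  filter_upwards [h1] with x hx
  rw [Pi.zero_apply, integral_indicator hsm] at hx
  refine measure_mono_null hs ?_
  simpa [Measure.real, ENNReal.toReal_eq_zero_iff] using hx

/-- Almost every ergodic component of an extension of an ergodic system is an extension. -/
theorem measurePreserving_invKernel_of_ergodic [StandardBorelSpace X] {Y : Type*}
    [MeasurableSpace Y] [StandardBorelSpace Y] {ν : Measure Y}
    [IsProbabilityMeasure ν] {μ : Measure X} [IsProbabilityMeasure μ] {S₁ S₂ : Y → Y}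
    {T₁ T₂ : X → X} {p : Y → X} (hp : MeasurePreserving p ν μ) (hS : CommPair ν S₁ S₂)
    (hT : CommPair μ T₁ T₂) (h₁ : ∀ y, p (S₁ y) = T₁ (p y)) (h₂ : ∀ y, p (S₂ y) = T₂ (p y))
    (herg : ∀ s, MeasurableSet[aeInv μ T₁ T₂] s → μ s = 0 ∨ μ s = 1) :
    ∀ᵐ y ∂ν, MeasurePreserving p (invKernel ν S₁ S₂ y) μ := by
  set 𝒜 := generateSetAlgebra (MeasurableSpace.countableGeneratingSet X)
  have hc : 𝒜.Countable :=
    countable_generateSetAlgebra MeasurableSpace.countable_countableGeneratingSet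
  have hgen : mX = MeasurableSpace.generateFrom 𝒜 := by
    rw [generateFrom_generateSetAlgebra_eq, MeasurableSpace.generateFrom_countableGeneratingSet]
  have hAm : ∀ A ∈ 𝒜, MeasurableSet A := fun A hA =>
    hgen ▸ MeasurableSpace.measurableSet_generateFrom hA
  have key : ∀ A ∈ 𝒜, ∀ᵐ y ∂ν, invKernel ν S₁ S₂ y (p ⁻¹' A) = μ A := by
    intro A hA
    have hAf : BddMeas (A.indicator fun _ => (1 : ℝ)) := .indicator_one (hAm A hA)
    filter_upwards [condExp_aeInv_comp_eq_const hp hS hT h₁ h₂ herg hAf,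
      (hAf.comp hp.measurable).condExp_ae_eq (μ := ν) (T₁ := S₁) (T₂ := S₂)] with y e1 e2
    have e3 : (fun y => A.indicator (fun _ => (1 : ℝ)) (p y)) =
      (p ⁻¹' A).indicator fun _ => (1 : ℝ) := rfl
    rw [e2, e3, integral_indicator (hAm A hA), integral_indicator (hp.measurable (hAm A hA))] at e1
    simpa [Measure.real, ENNReal.toReal_eq_toReal_iff' (measure_ne_top _ _) (measure_ne_top _ _)]
      using e1
  filter_upwards [(ae_ball_iff hc).2 key] with y hy
  refine ⟨hp.measurable, ext_of_generate_finite 𝒜 hgen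
    isSetAlgebra_generateSetAlgebra.isSetRing.isSetSemiring.isPiSystem (fun A hA => ?_) ?_⟩
  · rw [Measure.map_apply hp.measurable (hAm A hA), hy A hA]
  · rw [Measure.map_apply hp.measurable MeasurableSet.univ, Set.preimage_univ, measure_univ,
      measure_univ]

end InvariantSets

section MagicExtension

variable {X : Type u} [mX : MeasurableSpace X]

/-- The first transformation of the magic extension. -/
def boxShift₁ (T₁ : X ≃ᵐ X) : (X × X) × (X × X) ≃ᵐ (X × X) × (X × X) :=
  (T₁.prodCongr (.refl X)).prodCongr (T₁.prodCongr (.refl X))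

/-- The second transformation of the magic extension. -/
def boxShift₂ (T₂ : X ≃ᵐ X) : (X × X) × (X × X) ≃ᵐ (X × X) × (X × X) :=
  (T₂.prodCongr T₂).prodCongr (.refl (X × X))

theorem commPair_boxShift [StandardBorelSpace X] {μ : Measure X} [IsProbabilityMeasure μ]
    {T₁ T₂ : X ≃ᵐ X} (h : CommPair μ T₁ T₂) :
    CommPair (boxMeas μ T₁ T₂) (boxShift₁ T₁) (boxShift₂ T₂) where
  left := measurePreserving_prodMap_relSq h.prodMap (measurePreserving_prodMap_id_relSq h.left)
    fun p => Prod.ext (h.comm p.1) rfl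
  right := measurePreserving_prodMap_id_relSq h.prodMap
  comm p := Prod.ext (Prod.ext (h.comm p.1.1) rfl) rfl

theorem measurable_invSigma_boxShift (T₁ T₂ : X ≃ᵐ X) :
    Measurable[invSigma (boxShift₁ T₁) ⊔ invSigma (boxShift₂ T₂)]
      fun p : (X × X) × (X × X) => (p.1.2, p.2) := by
  have h₁ : Measurable[invSigma (boxShift₁ T₁) ⊔ invSigma (boxShift₂ T₂)]
      fun p : (X × X) × (X × X) => p.1.2 := fun s hs =>
    (le_sup_left : invSigma (boxShift₁ T₁) ≤ invSigma (boxShift₁ T₁) ⊔ invSigma (boxShift₂ T₂)) _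
      ⟨measurable_fst.snd hs, rfl⟩
  have h₂ : Measurable[invSigma (boxShift₁ T₁) ⊔ invSigma (boxShift₂ T₂)]
      fun p : (X × X) × (X × X) => p.2 := fun s hs =>
    (le_sup_right : invSigma (boxShift₂ T₂) ≤ invSigma (boxShift₁ T₁) ⊔ invSigma (boxShift₂ T₂)) _
      ⟨measurable_snd hs, rfl⟩
  exact h₁.prodMk h₂

theorem le_of_measurable_coordinates {R : MeasurableSpace ((X × X) × (X × X))}
    (h₀ : @Measurable _ _ R mX fun p => p.1.1)
    (h₁ : @Measurable _ _ R Prod.instMeasurableSpace fun p => (p.1.2, p.2)) :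
    Prod.instMeasurableSpace ≤ R :=
  fun _ hs => ((h₀.prodMk h₁.fst).prodMk h₁.snd : @Measurable _ _ R
    Prod.instMeasurableSpace fun p => p) hs

theorem prod_eq_generateFrom_sup_invSigma (T₁ T₂ : X ≃ᵐ X) {𝒜 : Set (Set X)}
    (hgen : mX = MeasurableSpace.generateFrom 𝒜) :
    (Prod.instMeasurableSpace : MeasurableSpace ((X × X) × (X × X))) =
      MeasurableSpace.generateFrom
        {C | ∃ A ∈ 𝒜, C = (fun p : (X × X) × (X × X) => p.1.1) ⁻¹' A} ⊔
      (invSigma (boxShift₁ T₁) ⊔ invSigma (boxShift₂ T₂)) := by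
  refine le_antisymm ?_ (sup_le (MeasurableSpace.generateFrom_le ?_)
    (sup_le (invSigma_le _) (invSigma_le _)))
  · refine le_of_measurable_coordinates ?_
      ((measurable_invSigma_boxShift T₁ T₂).mono le_sup_right le_rfl)
    have h₀ : ∀ R : MeasurableSpace ((X × X) × (X × X)),
        (∀ A ∈ 𝒜, MeasurableSet[R] ((fun p : (X × X) × (X × X) => p.1.1) ⁻¹' A)) →
        @Measurable _ _ R mX fun p : (X × X) × (X × X) => p.1.1 := by
      intro R hR
      rw [hgen]
      exact measurable_generateFrom hR
    exact h₀ _ fun A hA => (le_sup_left : MeasurableSpace.generateFrom _ ≤ _) _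
      (MeasurableSpace.measurableSet_generateFrom ⟨A, hA, rfl⟩)
  · rintro _ ⟨A, hA, rfl⟩
    have hAm : MeasurableSet A := hgen ▸ MeasurableSpace.measurableSet_generateFrom hA
    exact measurable_fst.fst hAm

end MagicExtension

theorem exists_ergodic_magic_extension
    {X : Type u} [MeasurableSpace X] [StandardBorelSpace X]
    (μ : Measure X) [IsProbabilityMeasure μ]
    (T₁ T₂ : X ≃ᵐ X)
    (h₁ : MeasurePreserving T₁ μ μ) (h₂ : MeasurePreserving T₂ μ μ)
    (hcomm : ∀ x, T₁ (T₂ x) = T₂ (T₁ x))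
    (herg : ∀ s : Set X, MeasurableSet s → T₁ ⁻¹' s = s → T₂ ⁻¹' s = s →
      μ s = 0 ∨ μ s = 1) :
    ∃ (Y : Type u) (_ : MeasurableSpace Y) (ν : Measure Y) (S₁ S₂ : Y ≃ᵐ Y),
      IsProbabilityMeasure ν ∧
      MeasurePreserving S₁ ν ν ∧ MeasurePreserving S₂ ν ν ∧
      (∀ y, S₁ (S₂ y) = S₂ (S₁ y)) ∧
      (∀ s : Set Y, MeasurableSet s → S₁ ⁻¹' s = s → S₂ ⁻¹' s = s →
        ν s = 0 ∨ ν s = 1) ∧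
      IsMagic ν S₁ S₂ ∧
      ∃ π : Y → X, Measurable π ∧ Measure.map π ν = μ ∧
        (∀ᵐ y ∂ν, π (S₁ y) = T₁ (π y)) ∧ (∀ᵐ y ∂ν, π (S₂ y) = T₂ (π y)) := by
  have hT : CommPair μ T₁ T₂ := ⟨h₁, h₂, hcomm⟩
  have hS := commPair_boxShift hT
  have hπ : MeasurePreserving (fun p : (X × X) × (X × X) => p.1.1) (boxMeas μ T₁ T₂) μ :=
    CommPair.measurePreserving_fst_boxMeas
  set 𝒜 := generateSetAlgebra (MeasurableSpace.countableGeneratingSet X)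
  have hc : 𝒜.Countable :=
    countable_generateSetAlgebra MeasurableSpace.countable_countableGeneratingSet
  have hgen : ‹MeasurableSpace X› = MeasurableSpace.generateFrom 𝒜 := by
    rw [generateFrom_generateSetAlgebra_eq, MeasurableSpace.generateFrom_countableGeneratingSet]
  have hpi : IsPiSystem 𝒜 :=
    isSetAlgebra_generateSetAlgebra.isSetRing.isSetSemiring.isPiSystem
  have hAf : ∀ A ∈ 𝒜, BddMeas (A.indicator fun _ => (1 : ℝ)) := fun A hA =>
    .indicator_one (hgen ▸ MeasurableSpace.measurableSet_generateFrom hA)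
  choose! g G hg hG hgG hg0 using fun A hA => exists_boxForm_decomposition hT (hAf A hA)
  have hgood := (invKernel_ergodic hS.left hS.right).and
    ((measurePreserving_invKernel_of_ergodic hπ hS hT (fun _ => rfl) (fun _ => rfl)
      fun s hs => hT.measure_eq_zero_or_one herg hs).and
    ((ae_ball_iff hc).2 fun A hA => ae_ae_invKernel (T₁ := boxShift₁ T₁) (T₂ := boxShift₂ T₂)
      (hgG A hA)))
  obtain ⟨y, ⟨hS₁, hS₂, hSerg⟩, hπy, hgGy⟩ := hgood.exists
  set ν := invKernel (boxMeas μ T₁ T₂) (boxShift₁ T₁) (boxShift₂ T₂) y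
  have hν : CommPair ν (boxShift₁ T₁) (boxShift₂ T₂) := ⟨hS₁, hS₂, hS.comm⟩
  refine ⟨(X × X) × (X × X), inferInstance, ν, boxShift₁ T₁, boxShift₂ T₂, inferInstance,
    hS₁, hS₂, hS.comm, fun s hs h h' => hSerg s hs h.eventuallyEq h'.eventuallyEq, ?_,
    fun p => p.1.1, hπy.measurable, hπy.map_eq, ae_of_all _ fun _ => rfl,
    ae_of_all _ fun _ => rfl⟩
  refine isMagic_of_decomposition hν
    (𝒞 := {C | ∃ A ∈ 𝒜, C = (fun p : (X × X) × (X × X) => p.1.1) ⁻¹' A})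
    ⟨Set.univ, isSetAlgebra_generateSetAlgebra.univ_mem, rfl⟩ ?_
    (prod_eq_generateFrom_sup_invSigma T₁ T₂ hgen) ?_
  · rintro _ ⟨A, hA, rfl⟩ _ ⟨A', hA', rfl⟩ ⟨p, hp⟩
    exact ⟨A ∩ A', hpi A hA A' hA' ⟨_, hp⟩, rfl⟩
  · rintro _ ⟨A, hA, rfl⟩
    have hu := (hAf A hA).sub (hg A hA)
    refine ⟨fun p => A.indicator (fun _ => (1 : ℝ)) p.1.1 - g A p.1.1, fun p => g A p.1.1,
      fun p => G A (p.1.2, p.2), hu.comp hπ.measurable,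
      (hG A hA).comp (measurable_fst.snd.prodMk measurable_snd),
      (hG A hA).1.comp (measurable_invSigma_boxShift T₁ T₂), hgGy A hA, ?_, fun p => ?_⟩
    · refine (hasBoxAvg_boxForm hν (hu.comp hπ.measurable)).unique ?_
      have := hasBoxAvg_boxForm hT hu
      rw [hg0 A hA] at this
      exact this.comp hπy h₁.measurable h₂.measurable (fun _ => rfl) (fun _ => rfl) hu
    · rw [sub_add_cancel]
      rfl
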